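/- arXiv:math/0606620 — 4 statements merged into one kernel-verified Lean document; each statement's English description precedes it below -/
import Mathlib

section
/- Let (μ_t)_{t≥0} be a skew convolution semigroup associated with (T_t)_{t≥0} such that ∫_H ‖x‖² μ_t(dx) < ∞ for every t ≥ 0. Define b_t = ∫_H x μ_t(dx) (Bochner integral) and μ^c_t = δ_{−b_t} * μ_t. Then (δ_{b_t})_{t≥0} and (μ^c_t)_{t≥0} are both skew convolution semigroups associated with (T_t)_{t≥0}, each μ^c_t is centered, and μ_t = μ^c_t * δ_{b_t} for every t ≥ 0. -/
open MeasureTheory Real Filter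
open scoped ENNReal InnerProductSpace NNReal

noncomputable section

/-- A strongly continuous semigroup of bounded linear operators on `H`. -/
def IsC0 {H : Type*} [NormedAddCommGroup H] [NormedSpace ℝ H]
    (T : ℝ → H →L[ℝ] H) : Prop :=
  T 0 = ContinuousLinearMap.id ℝ H ∧
  (∀ s t : ℝ, 0 ≤ s → 0 ≤ t → T (s + t) = (T s).comp (T t)) ∧
  ∀ x : H, ContinuousOn (fun t => T t x) (Set.Ici 0)

/-- Convolution of two measures on an additive measurable group. -/
def mconv {G : Type*} [MeasurableSpace G] [Add G] (μ ν : Measure G) : Measure G :=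
  (μ.prod ν).map fun p => p.1 + p.2

/-- A skew convolution semigroup (SC-semigroup) associated with `(T_t)`:
a family of Borel probability measures `(μ_t)_{t ≥ 0}` on `H` with
`μ_{r+t} = (T_t μ_r) * μ_t` for all `r, t ≥ 0`. -/
def IsSC {H : Type*} [NormedAddCommGroup H] [NormedSpace ℝ H] [MeasurableSpace H]
    (T : ℝ → H →L[ℝ] H) (μ : ℝ → Measure H) : Prop :=
  (∀ t : ℝ, 0 ≤ t → IsProbabilityMeasure (μ t)) ∧
  ∀ r t : ℝ, 0 ≤ r → 0 ≤ t → μ (r + t) = mconv ((μ r).map (T t)) (μ t)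

theorem mconv_eq_conv {G : Type*} [MeasurableSpace G] [AddMonoid G] (μ ν : Measure G) :
    mconv μ ν = Measure.conv μ ν := rfl

theorem integrable_id_of_lintegral_nnnorm_sq_lt_top {E : Type*} [NormedAddCommGroup E]
    [MeasurableSpace E] [BorelSpace E] [SecondCountableTopology E]
    {ν : Measure E} [IsFiniteMeasure ν]
    (h : ∫⁻ x, (‖x‖₊ : ℝ≥0∞) ^ 2 ∂ν < ⊤) : Integrable (fun x : E => x) ν := by
  have hmem : MemLp (fun x : E => x) 2 ν := by
    refine ⟨aestronglyMeasurable_id, ?_⟩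
    rw [eLpNorm_lt_top_iff_lintegral_rpow_enorm_lt_top (by norm_num) (by norm_num)]
    simpa [enorm_eq_nnnorm] using h
  exact hmem.integrable (by norm_num)

theorem integral_id_conv {E : Type*} [NormedAddCommGroup E] [NormedSpace ℝ E] [CompleteSpace E]
    [MeasurableSpace E] [BorelSpace E] [SecondCountableTopology E]
    {ν ρ : Measure E} [IsProbabilityMeasure ν] [IsProbabilityMeasure ρ]
    (hν : Integrable (fun x : E => x) ν) (hρ : Integrable (fun x : E => x) ρ) :
    ∫ x, x ∂(Measure.conv ν ρ) = (∫ x, x ∂ν) + ∫ x, x ∂ρ := by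
  rw [Measure.conv, integral_map (by fun_prop) (f := fun x => x) aestronglyMeasurable_id,
    integral_add (hν.comp_fst ρ) (hρ.comp_snd ν), integral_fun_fst (fun x => x),
    integral_fun_snd (fun x => x)]
  simp

/-- Decomposition of an SC-semigroup with finite second moments into a centered
SC-semigroup and a degenerate one:  with `b_t = ∫_H x μ_t(dx)` and
`μᶜ_t = δ_{-b_t} * μ_t`, both `(δ_{b_t})` and `(μᶜ_t)` are SC-semigroups associated
with `(T_t)`, each `μᶜ_t` is centered, and `μ_t = μᶜ_t * δ_{b_t}`. -/
theorem sc_semigroup_centered_decomposition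
    {H : Type*} [NormedAddCommGroup H] [InnerProductSpace ℝ H] [CompleteSpace H]
    [MeasurableSpace H] [BorelSpace H] [SecondCountableTopology H]
    (T : ℝ → H →L[ℝ] H) (hT : IsC0 T)
    (μ : ℝ → Measure H) (hμ : IsSC T μ)
    (hmom : ∀ t : ℝ, 0 ≤ t → ∫⁻ x, (‖x‖₊ : ℝ≥0∞) ^ 2 ∂(μ t) < ⊤)
    (b : ℝ → H) (hb : ∀ t : ℝ, 0 ≤ t → b t = ∫ x, x ∂(μ t))
    (μc : ℝ → Measure H)
    (hμc : ∀ t : ℝ, 0 ≤ t → μc t = mconv (Measure.dirac (-(b t))) (μ t)) :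
    IsSC T (fun t => Measure.dirac (b t)) ∧
    IsSC T μc ∧
    (∀ t : ℝ, 0 ≤ t → ∫ x, x ∂(μc t) = 0) ∧
    (∀ t : ℝ, 0 ≤ t → μ t = mconv (μc t) (Measure.dirac (b t))) := by
  simp only [IsSC, mconv_eq_conv] at *
  obtain ⟨hprob, hsc⟩ := hμ
  have hint : ∀ t, 0 ≤ t → Integrable (fun x : H => x) (μ t) := fun t ht => by
    have := hprob t ht
    exact integrable_id_of_lintegral_nnnorm_sq_lt_top (hmom t ht)
  have hmapprob : ∀ r t, 0 ≤ r → IsProbabilityMeasure ((μ r).map (T t)) := fun r t hr => by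
    have := hprob r hr
    exact Measure.isProbabilityMeasure_map (T t).measurable.aemeasurable
  have hbadd : ∀ r t, 0 ≤ r → 0 ≤ t → b (r + t) = T t (b r) + b t := fun r t hr ht => by
    have := hprob t ht
    have := hmapprob r t hr
    have hmapint : Integrable (fun x : H => x) ((μ r).map (T t)) :=
      (integrable_map_measure aestronglyMeasurable_id (T t).measurable.aemeasurable).2
        ((T t).integrable_comp (hint r hr))
    rw [hb _ (add_nonneg hr ht), hsc r t hr ht, integral_id_conv hmapint (hint t ht), hb t ht,
      hb r hr, integral_map (T t).measurable.aemeasurable (f := fun x => x)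
        aestronglyMeasurable_id,
      (T t).integral_comp_comm (hint r hr)]
  refine ⟨⟨fun t _ => inferInstance, fun r t hr ht => ?_⟩, ⟨fun t ht => ?_, fun r t hr ht => ?_⟩,
    fun t ht => ?_, fun t ht => ?_⟩
  · rw [Measure.map_dirac' (T t).measurable, Measure.dirac_conv_dirac, hbadd r t hr ht]
  · have := hprob t ht
    rw [hμc t ht]
    infer_instance
  · have := hprob r hr
    have := hprob t ht
    have := hmapprob r t hr
    rw [hμc _ (add_nonneg hr ht), hμc r hr, hμc t ht, hsc r t hr ht,
      Measure.map_conv_continuousLinearMap, Measure.map_dirac' (T t).measurable, hbadd r t hr ht,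
      neg_add, map_neg, ← Measure.dirac_conv_dirac, Measure.conv_assoc, Measure.conv_assoc,
      ← Measure.conv_assoc (Measure.dirac (-b t)),
      Measure.conv_comm (Measure.dirac (-b t)) ((μ r).map (T t)), Measure.conv_assoc]
  · have := hprob t ht
    rw [hμc t ht, integral_id_conv (integrable_dirac (by simp)) (hint t ht), integral_dirac,
      hb t ht, neg_add_cancel]
  · have := hprob t ht
    rw [hμc t ht, Measure.conv_comm, ← Measure.conv_assoc, Measure.dirac_conv_dirac,
      add_neg_cancel, Measure.dirac_zero_conv]
end
end

section
/- Let x̃ be an entrance path for (T_t)_{t≥0}. Then the following are equivalent: (i) ∫_0^l ‖x̃(s)‖² ds < ∞ for some l > 0; (ii) ∫_0^l ‖x̃(s)‖² ds < ∞ for all l > 0; (iii) ∫_0^∞ e^{−2bs} ‖x̃(s)‖² ds < ∞ for all b > b₀. -/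
open MeasureTheory Real Filter
open scoped ENNReal InnerProductSpace NNReal

noncomputable section

/-- An entrance path for the semigroup `(T_t)`: a map `x̃ : (0,∞) → H` with
`x̃(r+t) = T_t x̃(r)` for all `r,t > 0` (normalized to vanish on `(-∞,0]`). -/
def IsEntrance {H : Type*} [NormedAddCommGroup H] [NormedSpace ℝ H]
    (T : ℝ → H →L[ℝ] H) (x : ℝ → H) : Prop :=
  (∀ s : ℝ, s ≤ 0 → x s = 0) ∧ ∀ r t : ℝ, 0 < r → 0 < t → x (r + t) = T t (x r)

/-- The semigroup bound transported to an entrance path. -/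
lemma IsEntrance.norm_le {H : Type*} [NormedAddCommGroup H] [NormedSpace ℝ H]
    {T : ℝ → H →L[ℝ] H} {x : ℝ → H} (hx : IsEntrance T x) {c₀ b₀ : ℝ}
    (hbd : ∀ t : ℝ, 0 ≤ t → ‖T t‖ ≤ c₀ * Real.exp (b₀ * t))
    {r s : ℝ} (hr : 0 < r) (hrs : r < s) :
    ‖x s‖ ≤ c₀ * Real.exp (b₀ * (s - r)) * ‖x r‖ := by
  have h := hx.2 r (s - r) hr (sub_pos.2 hrs)
  rw [add_sub_cancel] at h
  rw [h]
  exact (T (s - r)).le_of_opNorm_le (hbd _ (sub_pos.2 hrs).le) _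

/-- Away from zero, the exponentially weighted square norm of an entrance path has finite
integral. -/
lemma IsEntrance.lintegral_Ici_lt_top {H : Type*} [NormedAddCommGroup H] [NormedSpace ℝ H]
    {T : ℝ → H →L[ℝ] H} {x : ℝ → H} (hx : IsEntrance T x) {c₀ b₀ : ℝ}
    (hbd : ∀ t : ℝ, 0 ≤ t → ‖T t‖ ≤ c₀ * Real.exp (b₀ * t))
    {b : ℝ} (hb : b₀ < b) {l : ℝ} (hl : 0 < l) :
    ∫⁻ s in Set.Ici l, ENNReal.ofReal (Real.exp (-2 * b * s)) * (‖x s‖₊ : ℝ≥0∞) ^ 2 < ⊤ := by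
  set K : ℝ := (c₀ * Real.exp (-b₀ * (l / 2)) * ‖x (l / 2)‖) ^ 2 with hK
  have hint : IntegrableOn (fun s => K * Real.exp (-(2 * (b - b₀)) * s)) (Set.Ici l) := by
    rw [integrableOn_Ici_iff_integrableOn_Ioi]
    exact (exp_neg_integrableOn_Ioi l (by linarith)).const_mul K
  refine lt_of_le_of_lt (setLIntegral_mono' measurableSet_Ici fun s hs => ?_)
    hint.lintegral_lt_top
  have hs' : l / 2 < s := by linarith [Set.mem_Ici.1 hs]
  have h := hx.norm_le hbd (half_pos hl) hs'
  rw [← enorm_eq_nnnorm, ← ofReal_norm, ← ENNReal.ofReal_pow (norm_nonneg _),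
    ← ENNReal.ofReal_mul (Real.exp_pos _).le]
  refine ENNReal.ofReal_le_ofReal ?_
  calc Real.exp (-2 * b * s) * ‖x s‖ ^ 2
      ≤ Real.exp (-2 * b * s) * (c₀ * Real.exp (b₀ * (s - l / 2)) * ‖x (l / 2)‖) ^ 2 := by
        gcongr
    _ = K * Real.exp (-(2 * (b - b₀)) * s) := by
        have e₁ : Real.exp (b₀ * (s - l / 2)) =
            Real.exp (-b₀ * (l / 2)) * Real.exp (b₀ * s) := by
          rw [← Real.exp_add]; ring_nf
        have e₂ : Real.exp (-(2 * (b - b₀)) * s) =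
            Real.exp (-2 * b * s) * Real.exp (b₀ * s) ^ 2 := by
          rw [← Real.exp_nat_mul, ← Real.exp_add]; push_cast; ring_nf
        rw [e₁, e₂, hK]; ring

/-- Local square integrability at zero yields weighted square integrability on the half-line. -/
lemma IsEntrance.lintegral_Ioi_lt_top {H : Type*} [NormedAddCommGroup H] [NormedSpace ℝ H]
    {T : ℝ → H →L[ℝ] H} {x : ℝ → H} (hx : IsEntrance T x) {c₀ b₀ : ℝ} (hb₀ : 0 ≤ b₀)
    (hbd : ∀ t : ℝ, 0 ≤ t → ‖T t‖ ≤ c₀ * Real.exp (b₀ * t))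
    {b : ℝ} (hb : b₀ < b) {l : ℝ} (hl : 0 < l)
    (h : ∫⁻ s in Set.Ioo 0 l, (‖x s‖₊ : ℝ≥0∞) ^ 2 < ⊤) :
    ∫⁻ s in Set.Ioi 0, ENNReal.ofReal (Real.exp (-2 * b * s)) * (‖x s‖₊ : ℝ≥0∞) ^ 2 < ⊤ := by
  rw [← Set.Ioo_union_Ici_eq_Ioi hl]
  refine (lintegral_union_le _ _ _).trans_lt
    (ENNReal.add_lt_top.2 ⟨?_, hx.lintegral_Ici_lt_top hbd hb hl⟩)
  refine (setLIntegral_mono' measurableSet_Ioo fun s hs => ?_).trans_lt h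
  refine mul_le_of_le_one_left zero_le (ENNReal.ofReal_le_one.2 (Real.exp_le_one_iff.2 ?_))
  nlinarith [hs.1, mul_nonneg (hb₀.trans hb.le) hs.1.le]

/-- Exponentially weighted integrability on the half-line yields unweighted integrability near
zero. -/
lemma lintegral_Ioo_lt_top_of_exp_weight {f : ℝ → ℝ≥0∞} {b : ℝ} (hb : 0 ≤ b) (l : ℝ)
    (h : ∫⁻ s in Set.Ioi 0, ENNReal.ofReal (Real.exp (-2 * b * s)) * f s < ⊤) :
    ∫⁻ s in Set.Ioo 0 l, f s < ⊤ := by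
  calc ∫⁻ s in Set.Ioo 0 l, f s
      ≤ ∫⁻ s in Set.Ioo 0 l, ENNReal.ofReal (Real.exp (2 * b * l)) *
          (ENNReal.ofReal (Real.exp (-2 * b * s)) * f s) := by
        refine setLIntegral_mono' measurableSet_Ioo fun s hs => ?_
        rw [← mul_assoc, ← ENNReal.ofReal_mul (Real.exp_pos _).le, ← Real.exp_add]
        refine le_mul_of_one_le_left zero_le
          (ENNReal.one_le_ofReal.2 (Real.one_le_exp_iff.2 ?_))
        nlinarith [mul_nonneg hb (sub_nonneg.2 hs.2.le)]
    _ = ENNReal.ofReal (Real.exp (2 * b * l)) *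
          ∫⁻ s in Set.Ioo 0 l, ENNReal.ofReal (Real.exp (-2 * b * s)) * f s :=
        lintegral_const_mul' _ _ ENNReal.ofReal_ne_top
    _ < ⊤ := ENNReal.mul_lt_top ENNReal.ofReal_lt_top
        ((lintegral_mono_set Set.Ioo_subset_Ioi_self).trans_lt h)

/-- **Lemma 2.1.** For an entrance path `x̃`, local square integrability
`∫_0^l ‖x̃(s)‖² ds < ∞` for some `l > 0` is equivalent to its validity for all `l > 0`,
and also equivalent to `∫_0^∞ e^{-2bs} ‖x̃(s)‖² ds < ∞` for all `b > b₀`. -/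
theorem entrance_path_square_integrability_tfae
    {H : Type*} [NormedAddCommGroup H] [InnerProductSpace ℝ H]
    (T : ℝ → H →L[ℝ] H) (c₀ b₀ : ℝ) (hc₀ : 0 ≤ c₀) (hb₀ : 0 ≤ b₀)
    (hT : IsC0 T) (hbd : ∀ t : ℝ, 0 ≤ t → ‖T t‖ ≤ c₀ * Real.exp (b₀ * t))
    (x : ℝ → H) (hx : IsEntrance T x) :
    ((∃ l > (0:ℝ), ∫⁻ s in Set.Ioo 0 l, (‖x s‖₊ : ℝ≥0∞) ^ 2 < ⊤) ↔
      (∀ l > (0:ℝ), ∫⁻ s in Set.Ioo 0 l, (‖x s‖₊ : ℝ≥0∞) ^ 2 < ⊤)) ∧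
    ((∃ l > (0:ℝ), ∫⁻ s in Set.Ioo 0 l, (‖x s‖₊ : ℝ≥0∞) ^ 2 < ⊤) ↔
      (∀ b > b₀, ∫⁻ s in Set.Ioi 0,
        ENNReal.ofReal (Real.exp (-2 * b * s)) * (‖x s‖₊ : ℝ≥0∞) ^ 2 < ⊤)) := by
  have weighted : (∃ l > (0:ℝ), ∫⁻ s in Set.Ioo 0 l, (‖x s‖₊ : ℝ≥0∞) ^ 2 < ⊤) →
      ∀ b > b₀, ∫⁻ s in Set.Ioi 0,
        ENNReal.ofReal (Real.exp (-2 * b * s)) * (‖x s‖₊ : ℝ≥0∞) ^ 2 < ⊤ :=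
    fun ⟨_, hl, h⟩ _ hb => hx.lintegral_Ioi_lt_top hb₀ hbd hb hl h
  have unweighted : (∀ b > b₀, ∫⁻ s in Set.Ioi 0,
        ENNReal.ofReal (Real.exp (-2 * b * s)) * (‖x s‖₊ : ℝ≥0∞) ^ 2 < ⊤) →
      ∀ l > (0:ℝ), ∫⁻ s in Set.Ioo 0 l, (‖x s‖₊ : ℝ≥0∞) ^ 2 < ⊤ :=
    fun h l _ => lintegral_Ioo_lt_top_of_exp_weight (by linarith) l (h (b₀ + 1) (by linarith))
  exact ⟨⟨fun h => unweighted (weighted h), fun h => ⟨1, one_pos, h 1 one_pos⟩⟩,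
    ⟨weighted, fun h => ⟨1, one_pos, unweighted h 1 one_pos⟩⟩⟩
end
end

section
/- The entrance space H̃, equipped with the inner product ⟨x̃,ỹ⟩_∼ = ∫_0^∞ e^{−2bs} ⟨x̃(s),ỹ(s)⟩ ds, is complete: every sequence in H̃ that is Cauchy with respect to the induced norm ‖·‖_∼ converges in H̃. Hence (H̃, ⟨·,·⟩_∼) is a Hilbert space. -/
open MeasureTheory Real Filter
open scoped ENNReal InnerProductSpace NNReal

noncomputable section

/-- Membership in the entrance space `H̃`: a locally square integrable entrance path. -/
def MemHt {H : Type*} [NormedAddCommGroup H] [NormedSpace ℝ H]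
    (T : ℝ → H →L[ℝ] H) (x : ℝ → H) : Prop :=
  IsEntrance T x ∧ ∃ l > (0:ℝ), ∫⁻ s in Set.Ioo 0 l, (‖x s‖₊ : ℝ≥0∞) ^ 2 < ⊤

theorem IsEntrance.sub {H : Type*} [NormedAddCommGroup H] [NormedSpace ℝ H]
    {T : ℝ → H →L[ℝ] H} {x y : ℝ → H} (hx : IsEntrance T x) (hy : IsEntrance T y) :
    IsEntrance T (fun s => x s - y s) := by
  refine ⟨fun s hs => ?_, fun r t hr ht => ?_⟩
  · simp [hx.1 s hs, hy.1 s hs]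
  · simp [hx.2 r t hr ht, hy.2 r t hr ht]

theorem IsEntrance.continuousOn {H : Type*} [NormedAddCommGroup H] [NormedSpace ℝ H]
    {T : ℝ → H →L[ℝ] H} {x : ℝ → H} (hx : IsEntrance T x) (hT : IsC0 T) :
    ContinuousOn x (Set.Ioi 0) := by
  intro s hs
  have hs : 0 < s := hs
  apply ContinuousAt.continuousWithinAt
  have hc : ContinuousAt (fun u => T (u - s / 2) (x (s / 2))) s := by
    have h1 : ContinuousAt (fun t => T t (x (s / 2))) (s - s / 2) :=
      (hT.2.2 _).continuousAt (Ici_mem_nhds (by linarith))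
    exact ContinuousAt.comp (f := fun u : ℝ => u - s / 2) h1 (by fun_prop)
  refine hc.congr ?_
  filter_upwards [Ioi_mem_nhds (show s / 2 < s by linarith)] with u hu
  have hu : s / 2 < u := hu
  rw [← hx.2 (s / 2) (u - s / 2) (by linarith) (by linarith)]
  congr 1
  ring

/-- Evaluation at a positive time is bounded with respect to the weighted `L²` norm. -/
theorem IsEntrance.weighted_sq_norm_le {H : Type*} [NormedAddCommGroup H] [NormedSpace ℝ H]
    {T : ℝ → H →L[ℝ] H} {c₀ b₀ b : ℝ} (hb₀ : 0 ≤ b₀) (hb : 0 ≤ b)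
    (hbd : ∀ t : ℝ, 0 ≤ t → ‖T t‖ ≤ c₀ * Real.exp (b₀ * t))
    {z : ℝ → H} (hz : IsEntrance T z) (t : ℝ) :
    ENNReal.ofReal (Real.exp (-2 * b * t) * ‖z t‖ ^ 2) * ENNReal.ofReal t ≤
      ENNReal.ofReal ((c₀ * Real.exp (b₀ * t)) ^ 2) *
        ∫⁻ s in Set.Ioi 0, ENNReal.ofReal (Real.exp (-2 * b * s) * ‖z s‖ ^ 2) := by
  have hc₀ : 0 ≤ c₀ := by simpa using (norm_nonneg _).trans (hbd 0 le_rfl)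
  calc ENNReal.ofReal (Real.exp (-2 * b * t) * ‖z t‖ ^ 2) * ENNReal.ofReal t
      = ∫⁻ _ in Set.Ioo 0 t, ENNReal.ofReal (Real.exp (-2 * b * t) * ‖z t‖ ^ 2) := by
        rw [setLIntegral_const, Real.volume_Ioo, sub_zero]
    _ ≤ ∫⁻ s in Set.Ioo 0 t, ENNReal.ofReal ((c₀ * Real.exp (b₀ * t)) ^ 2) *
          ENNReal.ofReal (Real.exp (-2 * b * s) * ‖z s‖ ^ 2) := by
        refine setLIntegral_mono' measurableSet_Ioo fun s hs => ?_
        obtain ⟨hs0, hst⟩ := hs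
        rw [← ENNReal.ofReal_mul (sq_nonneg _)]
        apply ENNReal.ofReal_le_ofReal
        have hzt : z t = T (t - s) (z s) := by
          rw [← hz.2 s (t - s) hs0 (by linarith)]
          congr 1
          ring
        have hn : ‖z t‖ ≤ c₀ * Real.exp (b₀ * t) * ‖z s‖ := by
          rw [hzt]
          refine ((T (t - s)).le_opNorm _).trans ?_
          gcongr
          refine (hbd _ (by linarith)).trans ?_
          gcongr
          linarith
        have he : Real.exp (-2 * b * t) ≤ Real.exp (-2 * b * s) := by
          apply Real.exp_le_exp.2
          nlinarith
        calc Real.exp (-2 * b * t) * ‖z t‖ ^ 2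
            ≤ Real.exp (-2 * b * s) * (c₀ * Real.exp (b₀ * t) * ‖z s‖) ^ 2 := by gcongr
          _ = _ := by ring
    _ ≤ ∫⁻ s in Set.Ioi 0, ENNReal.ofReal ((c₀ * Real.exp (b₀ * t)) ^ 2) *
          ENNReal.ofReal (Real.exp (-2 * b * s) * ‖z s‖ ^ 2) :=
        lintegral_mono_set Set.Ioo_subset_Ioi_self
    _ = _ := lintegral_const_mul' _ _ ENNReal.ofReal_ne_top

theorem IsEntrance.of_tendsto {H : Type*} [NormedAddCommGroup H] [NormedSpace ℝ H]
    {T : ℝ → H →L[ℝ] H} {x : ℕ → ℝ → H} {y : ℝ → H} (hx : ∀ n, IsEntrance T (x n))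
    (hy : ∀ t, Tendsto (fun n => x n t) atTop (nhds (y t))) : IsEntrance T y := by
  refine ⟨fun s hs => ?_, fun r t hr ht => ?_⟩
  · refine tendsto_nhds_unique (hy s) ?_
    simp [(hx _).1 s hs]
  · refine tendsto_nhds_unique (hy (r + t)) ?_
    simp only [(hx _).2 r t hr ht]
    exact ((T t).continuous.tendsto _).comp (hy r)

/-- An entrance path at finite weighted `L²` distance from an element of the entrance space
belongs to the entrance space. -/
theorem MemHt.of_lintegral_sub_lt_top {H : Type*} [NormedAddCommGroup H] [NormedSpace ℝ H]
    {T : ℝ → H →L[ℝ] H} {b : ℝ} (hb : 0 ≤ b) (hT : IsC0 T) {x y : ℝ → H}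
    (hx : MemHt T x) (hy : IsEntrance T y)
    (hxy : ∫⁻ s in Set.Ioi 0, ENNReal.ofReal (Real.exp (-2 * b * s) * ‖x s - y s‖ ^ 2) < ⊤) :
    MemHt T y := by
  obtain ⟨hxe, l, hl, hfin⟩ := hx
  refine ⟨hy, l, hl, ?_⟩
  have hmeas : AEMeasurable (fun s => 2 * (‖x s‖₊ : ℝ≥0∞) ^ 2)
      (volume.restrict (Set.Ioo 0 l)) := by
    have h := ((hxe.continuousOn hT).mono
      (Set.Ioo_subset_Ioi_self : Set.Ioo 0 l ⊆ _)).aestronglyMeasurable (μ := volume) measurableSet_Ioo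
    exact (h.enorm.pow_const 2).const_mul 2
  have hle : ∀ s ∈ Set.Ioo 0 l, (‖y s‖₊ : ℝ≥0∞) ^ 2 ≤ 2 * (‖x s‖₊ : ℝ≥0∞) ^ 2 +
      ENNReal.ofReal (2 * Real.exp (2 * b * l)) *
        ENNReal.ofReal (Real.exp (-2 * b * s) * ‖x s - y s‖ ^ 2) := by
    intro s hs
    have e : ∀ v : H, (‖v‖₊ : ℝ≥0∞) = ENNReal.ofReal ‖v‖ := fun v =>
      (ofReal_norm v).symm
    have e2 : (2 : ℝ≥0∞) = ENNReal.ofReal 2 := by simp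
    rw [e, e, e2, ← ENNReal.ofReal_pow (norm_nonneg _), ← ENNReal.ofReal_pow (norm_nonneg _),
      ← ENNReal.ofReal_mul (by positivity), ← ENNReal.ofReal_mul (by positivity),
      ← ENNReal.ofReal_add (by positivity) (by positivity)]
    apply ENNReal.ofReal_le_ofReal
    have hexp : 1 ≤ Real.exp (2 * b * l) * Real.exp (-2 * b * s) := by
      rw [← Real.exp_add]
      apply Real.one_le_exp
      nlinarith [hs.2]
    have htri : ‖y s‖ ≤ ‖x s‖ + ‖x s - y s‖ := by
      simpa using norm_sub_le (x s) (x s - y s)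
    have hsq : ‖y s‖ ^ 2 ≤ 2 * ‖x s‖ ^ 2 + 2 * ‖x s - y s‖ ^ 2 := by
      nlinarith [norm_nonneg (y s), sq_nonneg (‖x s‖ - ‖x s - y s‖)]
    nlinarith [mul_le_mul_of_nonneg_right hexp (sq_nonneg ‖x s - y s‖)]
  refine (setLIntegral_mono' measurableSet_Ioo hle).trans_lt ?_
  rw [lintegral_add_left' hmeas, lintegral_const_mul' _ _ ENNReal.ofNat_ne_top,
    lintegral_const_mul' _ _ ENNReal.ofReal_ne_top]
  exact ENNReal.add_lt_top.2 ⟨ENNReal.mul_lt_top ENNReal.ofNat_lt_top hfin,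
    ENNReal.mul_lt_top ENNReal.ofReal_lt_top
      ((lintegral_mono_set Set.Ioo_subset_Ioi_self).trans_lt hxy)⟩


/-- **Lemma 2.2.** The entrance space `H̃`, with the (squared) distance
`∫_0^∞ e^{-2bs} ‖x̃(s) - ỹ(s)‖² ds` induced by the inner product
`⟨x̃,ỹ⟩_∼ = ∫_0^∞ e^{-2bs} ⟨x̃(s),ỹ(s)⟩ ds`, is complete: every `‖·‖_∼`-Cauchy
sequence in `H̃` converges to an element of `H̃`. -/
theorem entrance_space_complete
    {H : Type*} [NormedAddCommGroup H] [InnerProductSpace ℝ H] [CompleteSpace H]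
    (T : ℝ → H →L[ℝ] H) (c₀ b₀ b : ℝ) (hc₀ : 0 ≤ c₀) (hb₀ : 0 ≤ b₀) (hb : b₀ < b)
    (hT : IsC0 T) (hbd : ∀ t : ℝ, 0 ≤ t → ‖T t‖ ≤ c₀ * Real.exp (b₀ * t))
    (x : ℕ → ℝ → H) (hx : ∀ n, MemHt T (x n))
    (hcauchy : ∀ ε : ℝ, 0 < ε → ∃ N : ℕ, ∀ m ≥ N, ∀ n ≥ N,
      ∫⁻ s in Set.Ioi 0,
        ENNReal.ofReal (Real.exp (-2 * b * s) * ‖x n s - x m s‖ ^ 2) < ENNReal.ofReal ε) :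
    ∃ y : ℝ → H, MemHt T y ∧
      Tendsto (fun n => ∫⁻ s in Set.Ioi 0,
          ENNReal.ofReal (Real.exp (-2 * b * s) * ‖x n s - y s‖ ^ 2))
        atTop (nhds 0) := by
  have hb' : 0 ≤ b := hb₀.trans hb.le
  have hpt : ∀ t, CauchySeq fun n => x n t := by
    intro t
    rcases le_or_gt t 0 with ht | ht
    · have h0 : (fun n => x n t) = fun _ => 0 := funext fun n => (hx n).1.1 t ht
      rw [h0]
      exact cauchySeq_const 0
    set K : ℝ := (c₀ * Real.exp (b₀ * t)) ^ 2
    set A : ℝ := Real.exp (-2 * b * t) * t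
    have hA : 0 < A := by positivity
    have hK : 0 ≤ K := by positivity
    refine Metric.cauchySeq_iff.2 fun ε hε => ?_
    obtain ⟨N, hN⟩ := hcauchy (A * ε ^ 2 / (K + 1)) (by positivity)
    refine ⟨N, fun n hn m hm => ?_⟩
    have h1 := ((hx n).1.sub (hx m).1).weighted_sq_norm_le hb₀ hb' hbd t
    have h2 := h1.trans (mul_le_mul_right (hN m hm n hn).le _)
    rw [← ENNReal.ofReal_mul (by positivity), ← ENNReal.ofReal_mul (by positivity),
      ENNReal.ofReal_le_ofReal_iff (by positivity)] at h2
    have h3 : A * ‖x n t - x m t‖ ^ 2 < A * ε ^ 2 := by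
      calc A * ‖x n t - x m t‖ ^ 2
          = Real.exp (-2 * b * t) * ‖x n t - x m t‖ ^ 2 * t := by ring
        _ ≤ K * (A * ε ^ 2 / (K + 1)) := h2
        _ < A * ε ^ 2 := by
          rw [mul_div_assoc', div_lt_iff₀ (by positivity)]
          nlinarith [show 0 < A * ε ^ 2 by positivity]
    rw [dist_eq_norm]
    exact lt_of_pow_lt_pow_left₀ 2 hε.le (lt_of_mul_lt_mul_left h3 hA.le)
  choose y hy using fun t => cauchySeq_tendsto_of_complete (hpt t)
  have hye : IsEntrance T y := IsEntrance.of_tendsto (fun n => (hx n).1) hy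
  have hlim : ∀ ε : ℝ, 0 < ε → ∃ N : ℕ, ∀ n ≥ N,
      ∫⁻ s in Set.Ioi 0, ENNReal.ofReal (Real.exp (-2 * b * s) * ‖x n s - y s‖ ^ 2)
        ≤ ENNReal.ofReal ε := by
    intro ε hε
    obtain ⟨N, hN⟩ := hcauchy ε hε
    refine ⟨N, fun n hn => ?_⟩
    have hconv : ∀ s, Tendsto
        (fun m => ENNReal.ofReal (Real.exp (-2 * b * s) * ‖x n s - x m s‖ ^ 2)) atTop
        (nhds (ENNReal.ofReal (Real.exp (-2 * b * s) * ‖x n s - y s‖ ^ 2))) := fun s =>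
      ENNReal.tendsto_ofReal ((((hy s).const_sub (x n s)).norm.pow 2).const_mul _)
    have hmeas : ∀ m, AEMeasurable
        (fun s => ENNReal.ofReal (Real.exp (-2 * b * s) * ‖x n s - x m s‖ ^ 2))
        (volume.restrict (Set.Ioi 0)) := by
      intro m
      have hc : ContinuousOn (fun s => Real.exp (-2 * b * s) * ‖x n s - x m s‖ ^ 2)
          (Set.Ioi 0) :=
        ContinuousOn.mul (by fun_prop)
          ((((hx n).1.sub (hx m).1).continuousOn hT).norm.pow 2)
      exact (hc.aemeasurable measurableSet_Ioi).ennreal_ofReal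
    calc ∫⁻ s in Set.Ioi 0, ENNReal.ofReal (Real.exp (-2 * b * s) * ‖x n s - y s‖ ^ 2)
        = ∫⁻ s in Set.Ioi 0, liminf
            (fun m => ENNReal.ofReal (Real.exp (-2 * b * s) * ‖x n s - x m s‖ ^ 2)) atTop :=
          lintegral_congr fun s => (hconv s).liminf_eq.symm
      _ ≤ liminf (fun m => ∫⁻ s in Set.Ioi 0,
            ENNReal.ofReal (Real.exp (-2 * b * s) * ‖x n s - x m s‖ ^ 2)) atTop :=
          lintegral_liminf_le' hmeas
      _ ≤ liminf (fun _ : ℕ => ENNReal.ofReal ε) atTop := by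
          refine liminf_le_liminf ?_
          filter_upwards [eventually_ge_atTop N] with m hm
          exact (hN m hm n hn).le
      _ = ENNReal.ofReal ε := liminf_const _
  refine ⟨y, ?_, ?_⟩
  · obtain ⟨N, hN⟩ := hlim 1 one_pos
    exact (hx N).of_lintegral_sub_lt_top hb' hT hye
      ((hN N le_rfl).trans_lt ENNReal.ofReal_lt_top)
  · refine ENNReal.tendsto_nhds_zero.2 fun ε hε => ?_
    obtain ⟨δ, -, hδ0, hδ⟩ := ENNReal.lt_iff_exists_real_btwn.1 hε
    obtain ⟨N, hN⟩ := hlim δ (ENNReal.ofReal_pos.1 hδ0)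
    filter_upwards [eventually_ge_atTop N] with n hn
    exact (hN n hn).trans hδ.le
end
end

section
/- Let (μ_t)_{t≥0} be a family of centered Borel probability measures on H with ∫_H ‖x‖² μ_t(dx) < ∞ for all t ≥ 0. Then (μ_t)_{t≥0} is an SC-semigroup associated with (T_t)_{t≥0} if and only if there exists a family (ν_s)_{s>0} of centered infinitely divisible Borel probability measures on H satisfying ν_{r+t} = T_t ν_r for all r,t > 0 and ∫_0^t ∫_H ‖x‖² ν_s(dx) ds < ∞ for all t ≥ 0, such that the characteristic functionals satisfy μ̂_t(a) = exp{∫_0^t log ν̂_s(a) ds} for all t ≥ 0 and a ∈ H, where log ν̂_s denotes the unique continuous function on H with log ν̂_s(0) = 0 and ν̂_s(a) = exp{log ν̂_s(a)} for all a ∈ H. -/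
open MeasureTheory Real Filter
open scoped ENNReal InnerProductSpace NNReal

noncomputable section

/-- The characteristic functional `μ̂(a) = ∫_H e^{i⟨x,a⟩} μ(dx)`. -/
def charFn {H : Type*} [NormedAddCommGroup H] [InnerProductSpace ℝ H] [MeasurableSpace H]
    (μ : Measure H) (a : H) : ℂ :=
  ∫ x, Complex.exp ((⟪x, a⟫_ℝ : ℂ) * Complex.I) ∂μ

/-- `n`-fold convolution power of a measure. -/
def convPow {G : Type*} [MeasurableSpace G] [AddMonoid G] (ν : Measure G) : ℕ → Measure G
  | 0 => Measure.dirac 0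
  | n + 1 => mconv (convPow ν n) ν

/-- Infinite divisibility: for each `n ≥ 1`, `μ` is the `n`-fold convolution of
some probability measure. -/
def IsInfDiv {G : Type*} [MeasurableSpace G] [AddMonoid G] (μ : Measure G) : Prop :=
  ∀ n : ℕ, 1 ≤ n → ∃ ν : Measure G, IsProbabilityMeasure ν ∧ μ = convPow ν n

section Moments

set_option linter.unusedSectionVars false

variable {H : Type*} [NormedAddCommGroup H] [InnerProductSpace ℝ H] [CompleteSpace H]
  [MeasurableSpace H] [BorelSpace H] [SecondCountableTopology H]

lemma charFun_map_clm (μ : Measure H) (A : H →L[ℝ] H) (a : H) :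
    charFun (μ.map A) a = charFun μ (ContinuousLinearMap.adjoint A a) := by
  rw [charFun_apply, charFun_apply, integral_map A.continuous.aemeasurable
    (by fun_prop)]
  simp only [ContinuousLinearMap.adjoint_inner_right]

lemma charFun_mconv (μ ν : Measure H) [IsFiniteMeasure μ] [IsFiniteMeasure ν] (a : H) :
    charFun (mconv μ ν) a = charFun μ a * charFun ν a :=
  charFun_conv a

lemma isProbabilityMeasure_mconv (μ ν : Measure H) [IsProbabilityMeasure μ]
    [IsProbabilityMeasure ν] : IsProbabilityMeasure (mconv μ ν) :=
  Measure.isProbabilityMeasure_map (by fun_prop)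

lemma map_mconv (μ ν : Measure H) [IsProbabilityMeasure μ] [IsProbabilityMeasure ν]
    (A : H →L[ℝ] H) : (mconv μ ν).map A = mconv (μ.map A) (ν.map A) := by
  have := isProbabilityMeasure_mconv μ ν
  have := Measure.isProbabilityMeasure_map (μ := μ) A.continuous.aemeasurable
  have := Measure.isProbabilityMeasure_map (μ := ν) A.continuous.aemeasurable
  have := isProbabilityMeasure_mconv (μ.map A) (ν.map A)
  have := Measure.isProbabilityMeasure_map (μ := mconv μ ν) A.continuous.aemeasurable
  apply Measure.ext_of_charFun
  ext a
  simp only [charFun_map_clm, charFun_mconv]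

lemma isProbabilityMeasure_convPow (ρ : Measure H) [IsProbabilityMeasure ρ] (n : ℕ) :
    IsProbabilityMeasure (convPow ρ n) := by
  induction n with
  | zero => exact Measure.dirac.isProbabilityMeasure
  | succ n ih => exact isProbabilityMeasure_mconv _ _

lemma charFun_convPow (ρ : Measure H) [IsProbabilityMeasure ρ] (n : ℕ) (a : H) :
    charFun (convPow ρ n) a = charFun ρ a ^ n := by
  induction n with
  | zero => simp [convPow, charFun_dirac]
  | succ n ih =>
    have := isProbabilityMeasure_convPow ρ n
    rw [convPow, charFun_mconv, ih, pow_succ]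

lemma map_convPow (ρ : Measure H) [IsProbabilityMeasure ρ] (n : ℕ) (A : H →L[ℝ] H) :
    (convPow ρ n).map A = convPow (ρ.map A) n := by
  induction n with
  | zero => simp [convPow, Measure.map_dirac' A.continuous.measurable]
  | succ n ih =>
    have := isProbabilityMeasure_convPow ρ n
    rw [convPow, convPow, map_mconv, ih]

/-- A centered probability measure with finite second moment. -/
structure IsCenteredL2 (μ : Measure H) : Prop where
  isProb : IsProbabilityMeasure μ
  memLp : MemLp id 2 μ
  integral_eq_zero : ∫ x, x ∂μ = 0

/-- The second moment `∫ ‖x‖² μ(dx)`. -/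
def secondMoment (μ : Measure H) : ℝ := ∫ x, ‖x‖ ^ 2 ∂μ

lemma secondMoment_nonneg (μ : Measure H) : 0 ≤ secondMoment μ :=
  integral_nonneg fun _ => by positivity

lemma memLp_id_two_of_lintegral_lt_top {μ : Measure H}
    (h : ∫⁻ x, (‖x‖₊ : ℝ≥0∞) ^ 2 ∂μ < ⊤) : MemLp id 2 μ := by
  refine (memLp_two_iff_integrable_sq_norm (by fun_prop)).2 ⟨by fun_prop, ?_⟩
  simpa [HasFiniteIntegral, enorm_pow, enorm_eq_nnnorm] using h

lemma lintegral_sq_eq_ofReal_secondMoment {μ : Measure H} (h : MemLp id 2 μ) :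
    ∫⁻ x, (‖x‖₊ : ℝ≥0∞) ^ 2 ∂μ = ENNReal.ofReal (secondMoment μ) := by
  have hi : Integrable (fun x : H => ‖x‖ ^ 2) μ :=
    (memLp_two_iff_integrable_sq_norm (by fun_prop)).1 h
  rw [secondMoment, ofReal_integral_eq_lintegral_ofReal hi (ae_of_all _ fun _ => by positivity)]
  refine lintegral_congr fun x => ?_
  rw [ENNReal.ofReal_pow (norm_nonneg x), ofReal_norm, enorm_eq_nnnorm]

namespace IsCenteredL2

variable {μ ν ρ : Measure H}

lemma integrable_sq (h : IsCenteredL2 μ) : Integrable (fun x : H => ‖x‖ ^ 2) μ :=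
  (memLp_two_iff_integrable_sq_norm (by fun_prop)).1 h.memLp

lemma integrable_id (h : IsCenteredL2 μ) : Integrable (fun x : H => x) μ := by
  have := h.isProb
  exact h.memLp.integrable (by norm_num)

lemma integral_inner (h : IsCenteredL2 μ) (a : H) : ∫ x, ⟪x, a⟫_ℝ ∂μ = 0 := by
  have := _root_.integral_inner (𝕜 := ℝ) h.integrable_id a
  simp only [real_inner_comm a]
  rw [this, h.integral_eq_zero, inner_zero_right]

lemma map (h : IsCenteredL2 μ) (A : H →L[ℝ] H) : IsCenteredL2 (μ.map A) where
  isProb := by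
    have := h.isProb
    exact Measure.isProbabilityMeasure_map A.continuous.aemeasurable
  memLp := by
    rw [memLp_map_measure_iff (by fun_prop) (by fun_prop)]
    exact A.comp_memLp' h.memLp
  integral_eq_zero := by
    rw [integral_map A.continuous.aemeasurable (by fun_prop),
      A.integral_comp_comm h.integrable_id, h.integral_eq_zero, map_zero]

lemma secondMoment_map (A : H →L[ℝ] H) :
    secondMoment (μ.map A) = ∫ x, ‖A x‖ ^ 2 ∂μ := by
  rw [secondMoment, integral_map A.continuous.aemeasurable (by fun_prop)]

lemma secondMoment_map_le (h : IsCenteredL2 μ) (A : H →L[ℝ] H) {K : ℝ} (hK : ‖A‖ ≤ K) :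
    secondMoment (μ.map A) ≤ K ^ 2 * secondMoment μ := by
  rw [secondMoment_map, secondMoment, ← integral_const_mul]
  have h2 := (h.map A).integrable_sq
  rw [integrable_map_measure (by fun_prop) (by fun_prop)] at h2
  refine integral_mono h2 (h.integrable_sq.const_mul _) fun x => ?_
  simp only
  rw [← mul_pow]
  gcongr
  exact A.le_of_opNorm_le hK x

lemma dirac_zero : IsCenteredL2 (Measure.dirac (0 : H)) where
  isProb := inferInstance
  memLp := by
    refine (memLp_two_iff_integrable_sq_norm (by fun_prop)).2 ?_
    exact integrable_dirac (by simp)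
  integral_eq_zero := by simp

lemma memLp_mconv (hμ : IsCenteredL2 μ) (hν : IsCenteredL2 ν) : MemLp id 2 (mconv μ ν) := by
  have := hμ.isProb
  have := hν.isProb
  rw [mconv, memLp_map_measure_iff (by fun_prop) (by fun_prop)]
  exact (hμ.memLp.comp_fst ν).add (hν.memLp.comp_snd μ)

lemma mconv (hμ : IsCenteredL2 μ) (hν : IsCenteredL2 ν) : IsCenteredL2 (mconv μ ν) where
  isProb := by
    have := hμ.isProb
    have := hν.isProb
    exact isProbabilityMeasure_mconv μ ν
  memLp := memLp_mconv hμ hν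
  integral_eq_zero := by
    have := hμ.isProb
    have := hν.isProb
    rw [_root_.mconv, integral_map (by fun_prop) (by fun_prop),
      integral_add (hμ.integrable_id.comp_fst ν) (hν.integrable_id.comp_snd μ),
      integral_fun_fst (fun x : H => x), integral_fun_snd (fun x : H => x)]
    simp [hμ.integral_eq_zero, hν.integral_eq_zero]

lemma secondMoment_mconv (hμ : IsCenteredL2 μ) (hν : IsCenteredL2 ν) :
    secondMoment (_root_.mconv μ ν) = secondMoment μ + secondMoment ν := by
  have := hμ.isProb
  have := hν.isProb
  have h1 : Integrable (fun z : H × H => ‖z.1‖ ^ 2) (μ.prod ν) := hμ.integrable_sq.comp_fst ν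
  have h2 : Integrable (fun z : H × H => ‖z.2‖ ^ 2) (μ.prod ν) := hν.integrable_sq.comp_snd μ
  have h3 : Integrable (fun z : H × H => ⟪z.1, z.2⟫_ℝ) (μ.prod ν) :=
    (h1.add h2).mono' (by fun_prop) (ae_of_all _ fun z => by
      have := abs_real_inner_le_norm z.1 z.2
      simp only [Real.norm_eq_abs, Pi.add_apply]
      nlinarith [sq_nonneg (‖z.1‖ - ‖z.2‖), sq_nonneg ‖z.1‖, sq_nonneg ‖z.2‖])
  have h4 : ∫ z : H × H, ⟪z.1, z.2⟫_ℝ ∂(μ.prod ν) = 0 := by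
    rw [integral_prod_symm _ h3]
    simp [hμ.integral_inner]
  rw [secondMoment, _root_.mconv, integral_map (by fun_prop) (by fun_prop)]
  simp only [norm_add_sq_real]
  have h5 : Integrable (fun z : H × H => ‖z.1‖ ^ 2 + 2 * ⟪z.1, z.2⟫_ℝ) (μ.prod ν) :=
    h1.add (h3.const_mul 2)
  rw [integral_add h5 h2, integral_add h1 (h3.const_mul 2),
    integral_const_mul, h4, integral_fun_fst (fun x : H => ‖x‖ ^ 2),
    integral_fun_snd (fun x : H => ‖x‖ ^ 2)]
  simp [secondMoment]

lemma convPow (h : IsCenteredL2 ρ) (n : ℕ) : IsCenteredL2 (convPow ρ n) := by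
  induction n with
  | zero => exact dirac_zero
  | succ n ih => exact ih.mconv h

lemma secondMoment_convPow (h : IsCenteredL2 ρ) (n : ℕ) :
    secondMoment (_root_.convPow ρ n) = n * secondMoment ρ := by
  induction n with
  | zero => simp [_root_.convPow, secondMoment]
  | succ n ih =>
    rw [_root_.convPow, secondMoment_mconv (h.convPow n) h, ih]
    push_cast
    ring

end IsCenteredL2

lemma memLp_of_memLp_mconv {μ ν : Measure H} [IsProbabilityMeasure μ] [IsProbabilityMeasure ν]
    (h : MemLp id 2 (mconv μ ν)) : MemLp id 2 ν := by
  have h' := (memLp_two_iff_integrable_sq_norm (by fun_prop)).1 h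
  obtain ⟨x, hx⟩ := ((integrable_conv_iff (by fun_prop)).1 h').1.exists
  have h2 : MemLp (fun y : H => x + y) 2 ν := (memLp_two_iff_integrable_sq_norm (by fun_prop)).2 hx
  have h3 := (memLp_const (μ := ν) (p := 2) (-x)).add h2
  refine h3.congr_norm (by fun_prop) (ae_of_all _ fun y => ?_)
  simp

lemma integral_convPow {ρ : Measure H} [IsProbabilityMeasure ρ] (h : MemLp id 2 ρ) (n : ℕ) :
    Integrable (fun x : H => x) (convPow ρ n) ∧ ∫ x, x ∂(convPow ρ n) = n • ∫ x, x ∂ρ := by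
  have hi : Integrable (fun x : H => x) ρ := h.integrable (by norm_num)
  induction n with
  | zero => exact ⟨integrable_dirac (by simp), by simp [convPow]⟩
  | succ n ih =>
    have := isProbabilityMeasure_convPow ρ n
    have h1 := ih.1.comp_fst ρ
    have h2 := hi.comp_snd (convPow ρ n)
    constructor
    · rw [convPow, mconv, integrable_map_measure (by fun_prop) (by fun_prop)]
      exact h1.add h2
    · rw [convPow, mconv, integral_map (by fun_prop) (by fun_prop), integral_add h1 h2,
        integral_fun_fst (fun x : H => x), integral_fun_snd (fun x : H => x), ih.2]
      simp [succ_nsmul]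

lemma IsCenteredL2.of_convPow {ρ : Measure H} [IsProbabilityMeasure ρ] {n : ℕ} (hn : 1 ≤ n)
    (h : IsCenteredL2 (_root_.convPow ρ n)) : IsCenteredL2 ρ := by
  obtain ⟨k, rfl⟩ : ∃ k, n = k + 1 := ⟨n - 1, by omega⟩
  have := isProbabilityMeasure_convPow ρ k
  have hm : MemLp id 2 ρ := memLp_of_memLp_mconv h.memLp
  refine ⟨inferInstance, hm, ?_⟩
  have h1 := (integral_convPow hm (k + 1)).2
  rw [h.integral_eq_zero] at h1
  rw [← Nat.cast_smul_eq_nsmul ℝ] at h1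
  exact (smul_eq_zero.1 h1.symm).resolve_left (by positivity)

lemma norm_exp_I_sub_sub_le (y z : ℝ) :
    ‖(Complex.exp (y * Complex.I) - y * Complex.I) - (Complex.exp (z * Complex.I) - z * Complex.I)‖
      ≤ |y - z| * (|y| + |z|) := by
  have hd : ∀ w ∈ Set.uIcc z y, HasDerivWithinAt
      (fun w : ℝ => Complex.exp (w * Complex.I) - w * Complex.I)
      (Complex.exp (w * Complex.I) * (1 * Complex.I) - 1 * Complex.I) (Set.uIcc z y) w := by
    intro w _
    have h1 : HasDerivAt (fun w : ℝ => (w : ℂ) * Complex.I) (1 * Complex.I) w :=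
      (Complex.ofRealCLM.hasDerivAt (x := w)).mul_const Complex.I
    exact (h1.cexp.sub h1).hasDerivWithinAt
  have hb : ∀ w ∈ Set.uIcc z y,
      ‖Complex.exp (w * Complex.I) * (1 * Complex.I) - 1 * Complex.I‖ ≤ |y| + |z| := by
    intro w hw
    rw [one_mul, ← sub_one_mul, norm_mul, Complex.norm_I, mul_one, mul_comm (w : ℂ)]
    refine Real.norm_exp_I_mul_ofReal_sub_one_le.trans ?_
    rw [Real.norm_eq_abs]
    rcases Set.mem_uIcc.1 hw with h | h <;>
      exact abs_le.2 ⟨by linarith [neg_abs_le y, neg_abs_le z, abs_nonneg y, abs_nonneg z],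
        by linarith [le_abs_self y, le_abs_self z, abs_nonneg y, abs_nonneg z]⟩
  have := Convex.norm_image_sub_le_of_norm_hasDerivWithin_le hd hb (convex_uIcc z y)
    Set.left_mem_uIcc Set.right_mem_uIcc
  rw [mul_comm |y - z|]
  exact this

lemma integrable_exp_inner (μ : Measure H) [IsFiniteMeasure μ] (a : H) :
    Integrable (fun x : H => Complex.exp (⟪x, a⟫_ℝ * Complex.I)) μ :=
  Integrable.of_bound (by fun_prop) 1 (ae_of_all _ fun x => by
    rw [Complex.norm_exp_ofReal_mul_I])

lemma IsCenteredL2.norm_charFun_sub_le {μ : Measure H} (h : IsCenteredL2 μ) (a b : H) :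
    ‖charFun μ a - charFun μ b‖ ≤ ‖a - b‖ * (‖a‖ + ‖b‖) * secondMoment μ := by
  have := h.isProb
  have hint : ∀ a : H, Integrable (fun x : H => (⟪x, a⟫_ℝ : ℂ) * Complex.I) μ := fun a =>
    (h.integrable_id.inner_const (𝕜 := ℝ) a).ofReal.mul_const _
  have hz : ∀ a : H, ∫ x, (⟪x, a⟫_ℝ : ℂ) * Complex.I ∂μ = 0 := fun a => by
    rw [integral_mul_const, integral_complex_ofReal, h.integral_inner]; simp
  have he : charFun μ a - charFun μ b = ∫ x,
      ((Complex.exp (⟪x, a⟫_ℝ * Complex.I) - ⟪x, a⟫_ℝ * Complex.I)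
        - (Complex.exp (⟪x, b⟫_ℝ * Complex.I) - ⟪x, b⟫_ℝ * Complex.I)) ∂μ := by
    have hsub : ∀ a : H, Integrable (fun x : H => Complex.exp (⟪x, a⟫_ℝ * Complex.I)
        - ⟪x, a⟫_ℝ * Complex.I) μ := fun a => (integrable_exp_inner μ a).sub (hint a)
    rw [integral_sub (hsub a) (hsub b),
      integral_sub (integrable_exp_inner μ a) (hint a),
      integral_sub (integrable_exp_inner μ b) (hint b), hz, hz, sub_zero, sub_zero,
      charFun_apply, charFun_apply]
  rw [he, secondMoment, ← integral_const_mul]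
  refine norm_integral_le_of_norm_le (h.integrable_sq.const_mul _) (ae_of_all _ fun x => ?_)
  refine (norm_exp_I_sub_sub_le _ _).trans ?_
  rw [← inner_sub_right]
  calc |⟪x, a - b⟫_ℝ| * (|⟪x, a⟫_ℝ| + |⟪x, b⟫_ℝ|)
      ≤ (‖x‖ * ‖a - b‖) * (‖x‖ * ‖a‖ + ‖x‖ * ‖b‖) := by
        gcongr <;> exact abs_real_inner_le_norm _ _
    _ = ‖a - b‖ * (‖a‖ + ‖b‖) * ‖x‖ ^ 2 := by ring

lemma IsCenteredL2.norm_charFun_sub_one_le {μ : Measure H} (h : IsCenteredL2 μ) (a : H) :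
    ‖charFun μ a - 1‖ ≤ ‖a‖ ^ 2 * secondMoment μ := by
  have := h.isProb
  simpa [pow_two] using h.norm_charFun_sub_le a 0

/-- A measure with finite second moment whose characteristic function is quadratically close to
`1` is centered. -/
lemma integral_eq_zero_of_norm_charFun_sub_one_le {ν : Measure H} [IsProbabilityMeasure ν]
    (h : MemLp id 2 ν) {D : ℝ} (hD : ∀ a : H, ‖charFun ν a - 1‖ ≤ ‖a‖ ^ 2 * D) :
    ∫ x, x ∂ν = 0 := by
  have hsq : Integrable (fun x : H => ‖x‖ ^ 2) ν :=
    (memLp_two_iff_integrable_sq_norm (by fun_prop)).1 h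
  have hid : Integrable (fun x : H => x) ν := h.integrable (by norm_num)
  set m := ∫ x, x ∂ν with hm
  have hkey : ∀ a : H, |⟪m, a⟫_ℝ| ≤ ‖a‖ ^ 2 * (D + secondMoment ν) := by
    intro a
    have hint : Integrable (fun x : H => (⟪x, a⟫_ℝ : ℂ) * Complex.I) ν :=
      (hid.inner_const (𝕜 := ℝ) a).ofReal.mul_const _
    have hz : ∫ x, (⟪x, a⟫_ℝ : ℂ) * Complex.I ∂ν = ⟪m, a⟫_ℝ * Complex.I := by
      rw [integral_mul_const, integral_complex_ofReal]
      have := _root_.integral_inner (𝕜 := ℝ) hid a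
      simp only [real_inner_comm a]
      rw [this, real_inner_comm]
    have h1 : ‖charFun ν a - 1 - ⟪m, a⟫_ℝ * Complex.I‖ ≤ ‖a‖ ^ 2 * secondMoment ν := by
      have he : charFun ν a - 1 - ⟪m, a⟫_ℝ * Complex.I = ∫ x,
          ((Complex.exp (⟪x, a⟫_ℝ * Complex.I) - ⟪x, a⟫_ℝ * Complex.I) - 1) ∂ν := by
        have hsub : Integrable (fun x : H => Complex.exp (⟪x, a⟫_ℝ * Complex.I)
            - ⟪x, a⟫_ℝ * Complex.I) ν := (integrable_exp_inner ν a).sub hint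
        rw [integral_sub hsub (integrable_const _),
          integral_sub (integrable_exp_inner ν a) hint, hz, charFun_apply]
        simp
        ring
      rw [he, secondMoment, ← integral_const_mul]
      refine norm_integral_le_of_norm_le (hsq.const_mul _) (ae_of_all _ fun x => ?_)
      have h2 := norm_exp_I_sub_sub_le ⟪x, a⟫_ℝ 0
      simp only [Complex.ofReal_zero, zero_mul, Complex.exp_zero, sub_zero, abs_zero,
        add_zero] at h2
      refine h2.trans ?_
      calc |⟪x, a⟫_ℝ| * |⟪x, a⟫_ℝ| ≤ (‖x‖ * ‖a‖) * (‖x‖ * ‖a‖) := by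
            gcongr <;> exact abs_real_inner_le_norm _ _
        _ = ‖a‖ ^ 2 * ‖x‖ ^ 2 := by ring
    have h3 : ‖(⟪m, a⟫_ℝ : ℂ) * Complex.I‖ = |⟪m, a⟫_ℝ| := by simp
    rw [← h3]
    calc ‖(⟪m, a⟫_ℝ : ℂ) * Complex.I‖
        = ‖(charFun ν a - 1) - (charFun ν a - 1 - ⟪m, a⟫_ℝ * Complex.I)‖ := by congr 1; ring
      _ ≤ ‖a‖ ^ 2 * D + ‖a‖ ^ 2 * secondMoment ν := (norm_sub_le _ _).trans (add_le_add (hD a) h1)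
      _ = _ := by ring
  by_contra hne
  have hpos : 0 < ‖m‖ ^ 2 := by positivity
  set C := |D + secondMoment ν| + 1
  have hC : 0 < C := by positivity
  have h5 := hkey ((2 * C)⁻¹ • m)
  rw [inner_smul_right, real_inner_self_eq_norm_sq, norm_smul, Real.norm_eq_abs,
    abs_of_pos (by positivity : 0 < (2 * C)⁻¹), abs_of_pos (by positivity), mul_pow] at h5
  have h6 : D + secondMoment ν ≤ C := (le_abs_self _).trans (by simp [C])
  have h7 : (2 * C)⁻¹ * ‖m‖ ^ 2 ≤ (2 * C)⁻¹ ^ 2 * ‖m‖ ^ 2 * C :=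
    h5.trans (by gcongr)
  have h8 : (2 * C)⁻¹ ^ 2 * ‖m‖ ^ 2 * C = (2 * C)⁻¹ * ‖m‖ ^ 2 / 2 := by
    field_simp
  rw [h8] at h7
  have : 0 < (2 * C)⁻¹ * ‖m‖ ^ 2 := by positivity
  linarith

end Moments

section Tightness

set_option linter.unusedSectionVars false

variable {H : Type*} [NormedAddCommGroup H] [InnerProductSpace ℝ H] [CompleteSpace H]
  [MeasurableSpace H] [BorelSpace H] [SecondCountableTopology H]

/-- The operators `Q N` are contractions which cut off more and more finite-dimensional
directions, as do the projections onto the orthogonal complements of an exhausting sequence of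
finite-dimensional subspaces. -/
structure IsTailSequence (Q : ℕ → H →L[ℝ] H) : Prop where
  norm_le : ∀ N x, ‖Q N x‖ ≤ ‖x‖
  antitone : ∀ N M x, N ≤ M → ‖Q M x‖ ≤ ‖Q N x‖
  tendsto_zero : ∀ x, Tendsto (fun N => Q N x) atTop (nhds 0)
  finiteDimensional : ∀ N, ∃ V : Submodule ℝ H, FiniteDimensional ℝ V ∧ ∀ x, x - Q N x ∈ V

lemma exists_isTailSequence : ∃ Q : ℕ → H →L[ℝ] H, IsTailSequence Q := by
  let V : ℕ → Submodule ℝ H := fun N =>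
    Submodule.span ℝ (TopologicalSpace.denseSeq H '' Set.Iio N)
  have hfin : ∀ N, FiniteDimensional ℝ (V N) := fun N =>
    FiniteDimensional.span_of_finite ℝ ((Set.finite_Iio N).image _)
  have hmono : Monotone V := fun N M h =>
    Submodule.span_mono (Set.image_mono (Set.Iio_subset_Iio h))
  have hdense : ⊤ ≤ (⨆ N, V N).topologicalClosure := by
    have h1 : Set.range (TopologicalSpace.denseSeq H) ⊆ ((⨆ N, V N : Submodule ℝ H) : Set H) := by
      rintro _ ⟨n, rfl⟩
      exact Submodule.mem_iSup_of_mem (n + 1) (Submodule.subset_span ⟨n, by simp, rfl⟩)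
    rw [top_le_iff]
    exact (Submodule.dense_iff_topologicalClosure_eq_top).1
      ((TopologicalSpace.denseRange_denseSeq H).mono h1)
  have hmin : ∀ N (x y : H), y ∈ V N → ‖x - (V N).starProjection x‖ ≤ ‖x - y‖ := by
    intro N x y hy
    rw [Submodule.starProjection_minimal]
    exact ciInf_le ⟨0, by rintro _ ⟨z, rfl⟩; positivity⟩ (⟨y, hy⟩ : V N)
  refine ⟨fun N => ContinuousLinearMap.id ℝ H - (V N).starProjection, ?_, ?_, ?_, ?_⟩
  · intro N x
    simpa using hmin N x 0 (zero_mem _)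
  · intro N M x h
    exact hmin M x _ (hmono h (Submodule.starProjection_apply_mem _ _))
  · intro x
    have := (Submodule.starProjection_tendsto_self V hmono x hdense).const_sub x
    simpa using this
  · intro N
    refine ⟨V N, hfin N, fun x => ?_⟩
    simp

lemma measure_lt_norm_le {ρ : Measure H} (h : IsCenteredL2 ρ) (A : H →L[ℝ] H) {c e : ℝ}
    (hc : 0 < c) (he : secondMoment (ρ.map A) ≤ e * c ^ 2) :
    ρ {x | c < ‖A x‖} ≤ ENNReal.ofReal e := by
  have hprob := h.isProb
  have hi := (h.map A).integrable_sq
  rw [integrable_map_measure (by fun_prop) (by fun_prop)] at hi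
  have h1 := mul_meas_ge_le_integral_of_nonneg (μ := ρ) (f := fun x => ‖A x‖ ^ 2)
    (ae_of_all _ fun x => by positivity) hi (c ^ 2)
  rw [← IsCenteredL2.secondMoment_map] at h1
  have h2 : ρ.real {x | c ^ 2 ≤ ‖A x‖ ^ 2} ≤ e := by
    have : 0 < c ^ 2 := by positivity
    nlinarith
  have h3 : ρ {x | c < ‖A x‖} ≤ ρ {x | c ^ 2 ≤ ‖A x‖ ^ 2} :=
    measure_mono fun x (hx : c < ‖A x‖) => by
      simp only [Set.mem_ofPred_eq]
      gcongr
  refine h3.trans ?_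
  rw [← ofReal_measureReal]
  exact ENNReal.ofReal_le_ofReal h2

lemma isCompact_of_tail {Q : ℕ → H →L[ℝ] H} (hQ : IsTailSequence Q) (R : ℝ) (N : ℕ → ℕ) :
    IsCompact ({x : H | ‖x‖ ≤ R} ∩ ⋂ j : ℕ, {x : H | ‖Q (N j) x‖ ≤ 1 / ((j : ℝ) + 1)}) := by
  refine TotallyBounded.isCompact_of_isClosed (Metric.totallyBounded_iff.2 fun ε hε => ?_) ?_
  · obtain ⟨j, hj⟩ := exists_nat_one_div_lt (half_pos hε)
    obtain ⟨V, hV, hVmem⟩ := hQ.finiteDimensional (N j)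
    have : ProperSpace V := FiniteDimensional.proper ℝ V
    have hC : IsCompact ((Subtype.val : V → H) '' Metric.closedBall (0 : V) (R + R)) :=
      (isCompact_closedBall _ _).image continuous_subtype_val
    obtain ⟨t, ht, hcov⟩ := Metric.totallyBounded_iff.1 hC.totallyBounded (ε / 2) (half_pos hε)
    refine ⟨t, ht, fun x hx => ?_⟩
    have hxR : ‖x‖ ≤ R := hx.1
    have hxj : ‖Q (N j) x‖ ≤ 1 / ((j : ℝ) + 1) := Set.mem_iInter.1 hx.2 j
    have hmem : x - Q (N j) x ∈ (Subtype.val : V → H) '' Metric.closedBall (0 : V) (R + R) := by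
      refine ⟨⟨_, hVmem x⟩, ?_, rfl⟩
      rw [mem_closedBall_zero_iff]
      exact (norm_sub_le _ _).trans (add_le_add hxR ((hQ.norm_le _ _).trans hxR))
    obtain ⟨y, hy, hxy⟩ := Set.mem_iUnion₂.1 (hcov hmem)
    refine Set.mem_iUnion₂.2 ⟨y, hy, ?_⟩
    rw [Metric.mem_ball, dist_eq_norm] at hxy ⊢
    calc ‖x - y‖ = ‖(x - Q (N j) x - y) + Q (N j) x‖ := by congr 1; abel
      _ ≤ ‖x - Q (N j) x - y‖ + ‖Q (N j) x‖ := norm_add_le _ _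
      _ < ε := by linarith
  · refine (isClosed_le continuous_norm continuous_const).inter (isClosed_iInter fun j => ?_)
    exact isClosed_le (by fun_prop) continuous_const

lemma isTightMeasureSet_of_tail {Q : ℕ → H →L[ℝ] H} (hQ : IsTailSequence Q) {S : Set (Measure H)}
    (hS : ∀ ρ ∈ S, IsCenteredL2 ρ) {D : ℝ} (hD : ∀ ρ ∈ S, secondMoment ρ ≤ D)
    (htail : ∀ ε > 0, ∃ N, ∀ ρ ∈ S, secondMoment (ρ.map (Q N)) ≤ ε) : IsTightMeasureSet S := by
  rw [isTightMeasureSet_iff_exists_isCompact_measure_compl_le]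
  intro ε hε
  obtain ⟨e, he, hsum⟩ := ENNReal.exists_pos_sum_of_countable (ι := ℕ)
    (ENNReal.half_pos hε.ne').ne'
  obtain ⟨e₀, he₀, he₀'⟩ := ENNReal.lt_iff_exists_real_btwn.1 (ENNReal.half_pos hε.ne')
  have he₀pos : 0 < e₀ := by simpa using he₀'.1
  have hch : ∀ j : ℕ, ∃ N, ∀ ρ ∈ S,
      secondMoment (ρ.map (Q N)) ≤ (e j : ℝ) * (1 / ((j : ℝ) + 1)) ^ 2 := fun j =>
    htail _ (by have := he j; positivity)
  choose N hN using hch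
  set R := Real.sqrt (|D| / e₀) + 1 with hR
  have hRpos : 0 < R := by positivity
  have hRD : D ≤ e₀ * R ^ 2 := by
    have h1 : |D| / e₀ ≤ R ^ 2 := by
      calc |D| / e₀ = Real.sqrt (|D| / e₀) ^ 2 := (Real.sq_sqrt (by positivity)).symm
        _ ≤ R ^ 2 := by gcongr; simp [hR]
    rw [div_le_iff₀ he₀pos] at h1
    linarith [le_abs_self D]
  refine ⟨_, isCompact_of_tail hQ R N, fun ρ hρ => ?_⟩
  have hsub : ({x : H | ‖x‖ ≤ R} ∩ ⋂ j : ℕ, {x : H | ‖Q (N j) x‖ ≤ 1 / ((j : ℝ) + 1)})ᶜ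
      ⊆ {x | R < ‖ContinuousLinearMap.id ℝ H x‖} ∪
        ⋃ j : ℕ, {x : H | 1 / ((j : ℝ) + 1) < ‖Q (N j) x‖} := by
    intro x hx
    by_contra hcon
    simp only [Set.mem_union, Set.mem_ofPred_eq, Set.mem_iUnion, not_or, not_lt, not_exists] at hcon
    exact hx ⟨hcon.1, Set.mem_iInter.2 hcon.2⟩
  refine (measure_mono hsub).trans ((measure_union_le _ _).trans ?_)
  rw [← ENNReal.add_halves ε]
  refine add_le_add ?_ ?_
  · refine (measure_lt_norm_le (hS ρ hρ) _ hRpos (e := e₀) ?_).trans he₀'.2.le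
    simpa using (hD ρ hρ).trans hRD
  · refine (measure_iUnion_le _).trans (le_trans ?_ hsum.le)
    refine ENNReal.tsum_le_tsum fun j => ?_
    refine (measure_lt_norm_le (hS ρ hρ) _ (by positivity) (hN j ρ hρ)).trans ?_
    simp

/-- A form of the Lévy continuity theorem in Hilbert space, for centered measures with convergent
second moments. -/
lemma exists_isCenteredL2_charFun_eq {ρ : ℕ → Measure H} (hρ : ∀ n, IsCenteredL2 (ρ n))
    (htight : IsTightMeasureSet (Set.range ρ)) {D : ℝ}
    (hD : Tendsto (fun n => secondMoment (ρ n)) atTop (nhds D)) {g : H → ℂ}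
    (hg : ∀ a, Tendsto (fun n => charFun (ρ n) a) atTop (nhds (g a))) :
    ∃ ν : Measure H, IsCenteredL2 ν ∧ charFun ν = g ∧ secondMoment ν ≤ D := by
  let P : ℕ → ProbabilityMeasure H := fun n => ⟨ρ n, (hρ n).isProb⟩
  have hcomp : IsCompact (closure (Set.range P)) := by
    apply isCompact_closure_of_isTightMeasureSet
    convert! htight using 1
    ext m
    constructor
    · rintro ⟨_, ⟨n, rfl⟩, rfl⟩
      exact ⟨n, rfl⟩
    · rintro ⟨n, rfl⟩
      exact ⟨P n, ⟨n, rfl⟩, rfl⟩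
  obtain ⟨ν, -, φ, hφ, hlim⟩ := hcomp.isSeqCompact
    (fun n => subset_closure (Set.mem_range_self n) : ∀ n, P n ∈ closure (Set.range P))
  have hchar : charFun (ν : Measure H) = g := by
    ext a
    have h1 := (ProbabilityMeasure.tendsto_iff_forall_integral_rclike_tendsto ℂ).1 hlim
      (BoundedContinuousFunction.ofNormedAddCommGroup
        (fun x : H => Complex.exp (⟪x, a⟫_ℝ * Complex.I)) (by fun_prop) 1
        (fun x => by rw [Complex.norm_exp_ofReal_mul_I]))
    exact tendsto_nhds_unique h1 ((hg a).comp hφ.tendsto_atTop)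
  have hDn := hD.comp hφ.tendsto_atTop
  have hmom : ∫⁻ x, (‖x‖₊ : ℝ≥0∞) ^ 2 ∂(ν : Measure H) ≤ ENNReal.ofReal D := by
    have h1 := lintegral_le_liminf_lintegral_of_forall_isOpen_measure_le_liminf_measure
      (μ := (ν : Measure H)) (μs := fun n => (P (φ n) : Measure H)) (f := fun x : H => ‖x‖ ^ 2)
      (by fun_prop) (fun x => by positivity)
      (fun G hG => ProbabilityMeasure.le_liminf_measure_open_of_tendsto hlim hG)
    have h2 : ∀ x : H, ENNReal.ofReal (‖x‖ ^ 2) = (‖x‖₊ : ℝ≥0∞) ^ 2 := fun x => by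
      rw [ENNReal.ofReal_pow (norm_nonneg x), ofReal_norm, enorm_eq_nnnorm]
    simp only [h2] at h1
    have h3 : ∀ n, ∫⁻ x, (‖x‖₊ : ℝ≥0∞) ^ 2 ∂(P (φ n) : Measure H)
        = ENNReal.ofReal (secondMoment (ρ (φ n))) :=
      fun n => lintegral_sq_eq_ofReal_secondMoment (hρ (φ n)).memLp
    simp only [h3] at h1
    refine h1.trans (le_of_eq ?_)
    exact ((ENNReal.continuous_ofReal.tendsto D).comp hDn).liminf_eq
  have hL2 : MemLp id 2 (ν : Measure H) :=
    memLp_id_two_of_lintegral_lt_top (hmom.trans_lt ENNReal.ofReal_lt_top)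
  have hD0 : 0 ≤ D := ge_of_tendsto' hD fun n => secondMoment_nonneg _
  refine ⟨ν, ⟨inferInstance, hL2, ?_⟩, hchar, ?_⟩
  · refine integral_eq_zero_of_norm_charFun_sub_one_le hL2 (D := D) fun a => ?_
    rw [hchar]
    exact le_of_tendsto_of_tendsto' ((hg a).sub_const 1).norm (hD.const_mul (‖a‖ ^ 2))
      fun n => (hρ n).norm_charFun_sub_one_le a
  · rw [lintegral_sq_eq_ofReal_secondMoment hL2] at hmom
    exact (ENNReal.ofReal_le_ofReal_iff hD0).1 hmom

end Tightness

section Logarithm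

variable {X : Type*} [TopologicalSpace X] [PreconnectedSpace X]

lemma eq_of_pow_eq_of_continuous {f g : X → ℂ} (hf : Continuous f) (hg : Continuous g) {m : ℕ}
    (hm : m ≠ 0) (hne : ∀ x, g x ≠ 0) (hpow : ∀ x, f x ^ m = g x ^ m) {x₀ : X}
    (h0 : f x₀ = g x₀) (x : X) : f x = g x := by
  have hfin : ({z : ℂ | z ^ m = 1}).Finite := by
    have : NeZero m := ⟨hm⟩
    refine (Polynomial.nthRoots m (1 : ℂ)).toFinset.finite_toSet.subset fun z hz => ?_
    simpa [Polynomial.mem_nthRoots (Nat.pos_of_ne_zero hm)] using hz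
  have hdisc : IsDiscrete {z : ℂ | z ^ m = 1} :=
    isDiscrete_iff_discreteTopology.2 hfin.instDiscreteTopology
  have hc : ContinuousOn (fun x => f x / g x) Set.univ := (hf.div hg hne).continuousOn
  have h1 := isPreconnected_univ.constant_of_mapsTo hdisc hc
    (fun y _ => by
      rw [Set.mem_ofPred_eq, div_pow, hpow, div_self (pow_ne_zero _ (hne y))])
    (Set.mem_univ x) (Set.mem_univ x₀)
  rw [h0, div_self (hne x₀)] at h1
  exact (div_eq_one_iff_eq (hne x)).1 h1

lemma tendsto_mul_exp_div_sub_one (z : ℂ) :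
    Tendsto (fun n : ℕ => ((n : ℂ) + 1) * (Complex.exp (z / ((n : ℂ) + 1)) - 1)) atTop (nhds z) := by
  have h1 : HasDerivAt (fun w : ℂ => Complex.exp (z * w)) z 0 := by
    simpa using ((hasDerivAt_id (0 : ℂ)).const_mul z).cexp
  have h2 := h1.tendsto_slope_zero
  have h3 : Tendsto (fun n : ℕ => 1 / ((n : ℂ) + 1)) atTop (nhdsWithin 0 {0}ᶜ) := by
    refine tendsto_nhdsWithin_iff.2 ⟨tendsto_one_div_add_atTop_nhds_zero_nat, ?_⟩
    refine Eventually.of_forall fun n => ?_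
    have : (n : ℂ) + 1 ≠ 0 := Nat.cast_add_one_ne_zero n
    simp [this]
  refine (h2.comp h3).congr fun n => ?_
  simp [div_eq_mul_inv]

lemma eq_of_exp_eq_of_continuous {f g : X → ℂ} (hf : Continuous f) (hg : Continuous g)
    (hexp : ∀ x, Complex.exp (f x) = Complex.exp (g x)) {x₀ : X} (h0 : f x₀ = g x₀) (x : X) :
    f x = g x := by
  have key : ∀ n : ℕ, Complex.exp (f x / ((n : ℂ) + 1)) = Complex.exp (g x / ((n : ℂ) + 1)) := by
    intro n
    have hn : (n : ℂ) + 1 ≠ 0 := Nat.cast_add_one_ne_zero n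
    refine eq_of_pow_eq_of_continuous (f := fun x => Complex.exp (f x / ((n : ℂ) + 1)))
      (g := fun x => Complex.exp (g x / ((n : ℂ) + 1))) (by fun_prop) (by fun_prop)
      n.succ_ne_zero (fun _ => Complex.exp_ne_zero _) (fun y => ?_) (x₀ := x₀) (by simp only [h0]) x
    rw [← Complex.exp_nat_mul, ← Complex.exp_nat_mul]
    push_cast
    rw [mul_div_cancel₀ _ hn, mul_div_cancel₀ _ hn, hexp]
  refine tendsto_nhds_unique (tendsto_mul_exp_div_sub_one (f x)) ?_
  simpa only [key] using tendsto_mul_exp_div_sub_one (g x)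

end Logarithm

section Exponent

set_option linter.unusedSectionVars false

variable {H : Type*} [NormedAddCommGroup H] [InnerProductSpace ℝ H] [CompleteSpace H]
  [MeasurableSpace H] [BorelSpace H] [SecondCountableTopology H]

/-- The exponent `ℓ` of a centered infinitely divisible measure with finite second moment: every
`exp (ℓ / m)` is the characteristic function of a centered measure with finite second moment. -/
structure IsExponent (ℓ : H → ℂ) : Prop where
  continuous : Continuous ℓ
  map_zero : ℓ 0 = 0
  exists_root : ∀ m : ℕ, m ≠ 0 → ∃ ρ : Measure H, IsCenteredL2 ρ ∧
    ∀ a, charFun ρ a = Complex.exp (ℓ a / m)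

lemma IsCenteredL2.continuous_charFun {μ : Measure H} (h : IsCenteredL2 μ) :
    Continuous (charFun μ) := by
  have := h.isProb
  exact MeasureTheory.continuous_charFun

lemma isExponent_of_isInfDiv {ν : Measure H} (hν : IsCenteredL2 ν) (hdiv : IsInfDiv ν) {ℓ : H → ℂ}
    (hℓ : Continuous ℓ) (h0 : ℓ 0 = 0) (hexp : ∀ a, Complex.exp (ℓ a) = charFun ν a) :
    IsExponent ℓ := by
  refine ⟨hℓ, h0, fun m hm => ?_⟩
  obtain ⟨ρ, hρ, rfl⟩ := hdiv m (Nat.pos_of_ne_zero hm)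
  have hρ2 := hν.of_convPow (Nat.pos_of_ne_zero hm)
  refine ⟨ρ, hρ2, fun a => ?_⟩
  refine eq_of_pow_eq_of_continuous hρ2.continuous_charFun
    (g := fun a => Complex.exp (ℓ a / m)) (by fun_prop) hm (fun _ => Complex.exp_ne_zero _)
    (fun b => ?_) (x₀ := 0) (by simp [h0]) a
  rw [← charFun_convPow, ← hexp, ← Complex.exp_nat_mul, mul_div_cancel₀ _ (Nat.cast_ne_zero.2 hm)]

namespace IsExponent

variable {ℓ : H → ℂ}

lemma exists_convPow_eq (h : IsExponent ℓ) {ν : Measure H} (hν : IsCenteredL2 ν)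
    (hexp : ∀ a, charFun ν a = Complex.exp (ℓ a)) {m : ℕ} (hm : m ≠ 0) :
    ∃ ρ : Measure H, IsCenteredL2 ρ ∧ (∀ a, charFun ρ a = Complex.exp (ℓ a / m)) ∧
      ν = convPow ρ m := by
  obtain ⟨ρ, hρ, hch⟩ := h.exists_root m hm
  refine ⟨ρ, hρ, hch, ?_⟩
  have := hν.isProb
  have := hρ.isProb
  have := (hρ.convPow m).isProb
  apply Measure.ext_of_charFun
  ext a
  rw [hexp, charFun_convPow, hch, ← Complex.exp_nat_mul, mul_div_cancel₀ _ (Nat.cast_ne_zero.2 hm)]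

lemma isInfDiv (h : IsExponent ℓ) {ν : Measure H} (hν : IsCenteredL2 ν)
    (hexp : ∀ a, charFun ν a = Complex.exp (ℓ a)) : IsInfDiv ν := by
  intro m hm
  obtain ⟨ρ, hρ, -, hconv⟩ := h.exists_convPow_eq hν hexp (Nat.one_le_iff_ne_zero.1 hm)
  exact ⟨ρ, hρ.isProb, hconv⟩

lemma norm_le (h : IsExponent ℓ) {ν : Measure H} (hν : IsCenteredL2 ν)
    (hexp : ∀ a, charFun ν a = Complex.exp (ℓ a)) (a : H) :
    ‖ℓ a‖ ≤ ‖a‖ ^ 2 * secondMoment ν := by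
  refine le_of_tendsto' (tendsto_mul_exp_div_sub_one (ℓ a)).norm fun n => ?_
  obtain ⟨ρ, hρ, hch, rfl⟩ := h.exists_convPow_eq hν hexp n.succ_ne_zero
  have h1 := hρ.norm_charFun_sub_one_le a
  rw [hch] at h1
  push_cast at h1
  rw [norm_mul, hρ.secondMoment_convPow]
  have h2 : ‖(n : ℂ) + 1‖ = (n : ℝ) + 1 := by
    rw [← Nat.cast_add_one, Complex.norm_natCast]
    push_cast
    rfl
  rw [h2]
  push_cast
  calc ((n : ℝ) + 1) * ‖Complex.exp (ℓ a / ((n : ℂ) + 1)) - 1‖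
      ≤ ((n : ℝ) + 1) * (‖a‖ ^ 2 * secondMoment ρ) := by gcongr
    _ = _ := by ring

lemma comp_adjoint (h : IsExponent ℓ) (A : H →L[ℝ] H) :
    IsExponent fun a => ℓ (ContinuousLinearMap.adjoint A a) := by
  refine ⟨h.continuous.comp (ContinuousLinearMap.continuous _), by simp [h.map_zero],
    fun m hm => ?_⟩
  obtain ⟨ρ, hρ, hch⟩ := h.exists_root m hm
  exact ⟨ρ.map A, hρ.map A, fun a => by rw [charFun_map_clm, hch]⟩

end IsExponent

end Exponent

section Semigroup

set_option linter.unusedSectionVars false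

variable {H : Type*} [NormedAddCommGroup H] [InnerProductSpace ℝ H] [CompleteSpace H]
  [MeasurableSpace H] [BorelSpace H] [SecondCountableTopology H]
  {T : ℝ → H →L[ℝ] H}

lemma IsC0.exists_norm_le (hT : IsC0 T) (τ : ℝ) :
    ∃ K : ℝ, 1 ≤ K ∧ ∀ t ∈ Set.Icc 0 τ, ‖T t‖ ≤ K := by
  obtain ⟨C, hC⟩ := banach_steinhaus (g := fun t : Set.Icc (0 : ℝ) τ => T t) fun x => by
    obtain ⟨C, hC⟩ := isCompact_Icc.exists_bound_of_continuousOn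
      ((hT.2.2 x).mono (Set.Icc_subset_Ici_self : Set.Icc 0 τ ⊆ Set.Ici 0))
    exact ⟨C, fun t => hC t t.2⟩
  exact ⟨max C 1, le_max_right _ _, fun t ht => (hC ⟨t, ht⟩).trans (le_max_left _ _)⟩

lemma IsC0.continuousOn_charFun_map (hT : IsC0 T) {ρ : Measure H} [IsFiniteMeasure ρ] (a : H) :
    ContinuousOn (fun t => charFun (ρ.map (T t)) a) (Set.Ici 0) := by
  have h1 : ∀ t, charFun (ρ.map (T t)) a = ∫ x, Complex.exp (⟪T t x, a⟫_ℝ * Complex.I) ∂ρ := by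
    intro t
    rw [charFun_apply, integral_map (T t).continuous.aemeasurable (by fun_prop)]
  simp only [h1]
  refine continuousOn_of_dominated (bound := fun _ => 1) (fun t _ => by fun_prop)
    (fun t _ => ae_of_all _ fun x => by rw [Complex.norm_exp_ofReal_mul_I])
    (integrable_const _) (ae_of_all _ fun x => ?_)
  have := hT.2.2 x
  fun_prop

lemma IsC0.continuousOn_secondMoment_map (hT : IsC0 T) {ρ : Measure H} (hρ : IsCenteredL2 ρ) :
    ContinuousOn (fun t => secondMoment (ρ.map (T t))) (Set.Ici 0) := by
  have h2 : ∀ τ, ContinuousOn (fun t => secondMoment (ρ.map (T t))) (Set.Icc 0 τ) := by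
    intro τ
    obtain ⟨K, hK1, hK⟩ := hT.exists_norm_le τ
    simp only [IsCenteredL2.secondMoment_map]
    refine continuousOn_of_dominated (bound := fun x => K ^ 2 * ‖x‖ ^ 2) (fun t _ => by fun_prop)
      (fun t ht => ae_of_all _ fun x => ?_)
      (hρ.integrable_sq.const_mul _) (ae_of_all _ fun x => ?_)
    · rw [norm_pow, norm_norm, ← mul_pow]
      gcongr
      exact (T t).le_of_opNorm_le (hK t ht) x
    · have := (hT.2.2 x).mono (Set.Icc_subset_Ici_self : Set.Icc 0 τ ⊆ Set.Ici 0)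
      fun_prop
  intro t ht
  refine ((h2 (t + 1)) t ⟨ht, by linarith⟩).mono_of_mem_nhdsWithin ?_
  rw [← Set.Ici_inter_Iic]
  exact inter_mem self_mem_nhdsWithin (mem_nhdsWithin_of_mem_nhds (Iic_mem_nhds (by linarith)))

/-- A family of exponents of an entrance law of the semigroup `T`. -/
structure IsExponentFamily (T : ℝ → H →L[ℝ] H) (L : ℝ → H → ℂ) : Prop where
  isExponent : ∀ s, 0 < s → IsExponent (L s)
  add_eq : ∀ s r, 0 < s → 0 ≤ r → ∀ a, L (s + r) a = L s (ContinuousLinearMap.adjoint (T r) a)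

namespace IsExponentFamily

variable {L : ℝ → H → ℂ}

lemma continuousOn (hL : IsExponentFamily T L) (hT : IsC0 T) (a : H) :
    ContinuousOn (fun s => L s a) (Set.Ioi 0) := by
  intro s₁ hs₁
  have hs₁' : 0 < s₁ := hs₁
  set s₀ := s₁ / 2 with hs₀
  have hs₀pos : 0 < s₀ := by positivity
  have hexp := hL.isExponent s₀ hs₀pos
  obtain ⟨ν, hν, hch⟩ := hexp.exists_root 1 one_ne_zero
  simp only [Nat.cast_one, div_one] at hch
  obtain ⟨K, hK1, hK⟩ := hT.exists_norm_le s₁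
  set C := (K * ‖a‖) ^ 2 * secondMoment ν
  have hbound : ∀ s ∈ Set.Icc s₀ s₁ ∪ Set.Icc s₁ (s₀ + s₁), ‖L s a‖ ≤ C := by
    intro s hs
    have hs2 : s₀ ≤ s ∧ s ≤ s₀ + s₁ := by
      rcases hs with h | h <;> constructor <;> linarith [h.1, h.2]
    have h1 := hL.add_eq s₀ (s - s₀) hs₀pos (by linarith) a
    rw [add_sub_cancel] at h1
    rw [h1]
    refine (hexp.norm_le hν hch _).trans ?_
    have h3 := secondMoment_nonneg ν
    have h4 : ‖ContinuousLinearMap.adjoint (T (s - s₀)) a‖ ≤ K * ‖a‖ := by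
      refine ContinuousLinearMap.le_of_opNorm_le _ ?_ a
      rw [LinearIsometryEquiv.norm_map]
      exact hK _ ⟨by linarith, by linarith⟩
    exact mul_le_mul_of_nonneg_right (pow_le_pow_left₀ (norm_nonneg _) h4 2) h3
  obtain ⟨m, hm⟩ := exists_nat_gt C
  have hC0 : 0 ≤ C := mul_nonneg (by positivity) (secondMoment_nonneg ν)
  have hmpos : (0 : ℝ) < m := lt_of_le_of_lt hC0 hm
  have hm0 : m ≠ 0 := by
    rintro rfl
    simp at hmpos
  have hmC : (m : ℂ) ≠ 0 := Nat.cast_ne_zero.2 hm0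
  obtain ⟨ρ, hρ, hρch⟩ := hexp.exists_root m hm0
  have := hρ.isProb
  have hnhds : Set.Ioo s₀ (s₀ + s₁) ∈ nhds s₁ := Ioo_mem_nhds (by linarith) (by linarith)
  have hrepr : ∀ s ∈ Set.Ioo s₀ (s₀ + s₁),
      Complex.exp (L s a / m) = charFun (ρ.map (T (s - s₀))) a := by
    intro s hs
    have h1 := hL.add_eq s₀ (s - s₀) hs₀pos (by linarith [hs.1]) a
    rw [add_sub_cancel] at h1
    rw [charFun_map_clm, hρch, h1]
  have hsmall : ∀ s ∈ Set.Ioo s₀ (s₀ + s₁), |(L s a / m).im| < 1 := by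
    intro s hs
    have h1 : ‖L s a‖ ≤ C := hbound s (by
      rcases le_total s s₁ with h | h
      · exact Or.inl ⟨hs.1.le, h⟩
      · exact Or.inr ⟨h, hs.2.le⟩)
    refine (Complex.abs_im_le_norm _).trans_lt ?_
    rw [norm_div, Complex.norm_natCast, div_lt_one hmpos]
    exact h1.trans_lt hm
  have hcont : ContinuousAt (fun s => charFun (ρ.map (T (s - s₀))) a) s₁ := by
    have h1 := ((hT.continuousOn_charFun_map (ρ := ρ) a) (s₁ - s₀) (by
      simp only [Set.mem_Ici]; linarith)).continuousAt (Ici_mem_nhds (by linarith))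
    exact ContinuousAt.comp (f := fun s => s - s₀) h1 (by fun_prop)
  have hslit : charFun (ρ.map (T (s₁ - s₀))) a ∈ Complex.slitPlane := by
    rw [← hrepr s₁ (mem_of_mem_nhds hnhds)]
    left
    rw [Complex.exp_re]
    have h1 := abs_lt.1 (hsmall s₁ (mem_of_mem_nhds hnhds))
    have h2 : 0 < Real.cos (L s₁ a / m).im :=
      Real.cos_pos_of_mem_Ioo ⟨by linarith [Real.pi_gt_three], by linarith [Real.pi_gt_three]⟩
    positivity
  have hfin : ContinuousAt (fun s => m * Complex.log (charFun (ρ.map (T (s - s₀))) a)) s₁ :=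
    (hcont.clog hslit).const_mul _
  refine (hfin.congr ?_).continuousWithinAt
  filter_upwards [hnhds] with s hs
  have h1 := abs_lt.1 (hsmall s hs)
  rw [← hrepr s hs, Complex.log_exp (by linarith [Real.pi_gt_three])
    (by linarith [Real.pi_gt_three]), mul_div_cancel₀ _ hmC]

lemma integrableOn (hL : IsExponentFamily T L) (hT : IsC0 T) {ν : ℝ → Measure H} {t : ℝ}
    (hν : ∀ s, 0 < s → IsCenteredL2 (ν s))
    (hexp : ∀ s, 0 < s → ∀ a, charFun (ν s) a = Complex.exp (L s a))
    (hint : ∫⁻ s in Set.Ioo 0 t, ∫⁻ x, (‖x‖₊ : ℝ≥0∞) ^ 2 ∂(ν s) < ⊤) (a : H) :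
    IntegrableOn (fun s => L s a) (Set.Ioo 0 t) := by
  refine ⟨((hL.continuousOn hT a).mono Set.Ioo_subset_Ioi_self).aestronglyMeasurable
    measurableSet_Ioo, ?_⟩
  have h1 : ∀ s ∈ Set.Ioo 0 t,
      ‖L s a‖ₑ ≤ ENNReal.ofReal (‖a‖ ^ 2) * ∫⁻ x, (‖x‖₊ : ℝ≥0∞) ^ 2 ∂(ν s) := by
    intro s hs
    rw [lintegral_sq_eq_ofReal_secondMoment (hν s hs.1).memLp, ← ENNReal.ofReal_mul (by positivity),
      ← ofReal_norm]
    exact ENNReal.ofReal_le_ofReal ((hL.isExponent s hs.1).norm_le (hν s hs.1) (hexp s hs.1) a)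
  refine (setLIntegral_mono' measurableSet_Ioo h1).trans_lt ?_
  rw [lintegral_const_mul' _ _ ENNReal.ofReal_ne_top]
  exact ENNReal.mul_lt_top ENNReal.ofReal_lt_top hint

end IsExponentFamily

end Semigroup

section Converse

set_option linter.unusedSectionVars false

variable {H : Type*} [NormedAddCommGroup H] [InnerProductSpace ℝ H] [CompleteSpace H]
  [MeasurableSpace H] [BorelSpace H] [SecondCountableTopology H]
  {T : ℝ → H →L[ℝ] H}

lemma isCenteredL2_of_lintegral_lt_top {ν : Measure H} [hν : IsProbabilityMeasure ν]
    (hcent : ∫ x, x ∂ν = 0) (h : ∫⁻ x, (‖x‖₊ : ℝ≥0∞) ^ 2 ∂ν < ⊤) : IsCenteredL2 ν :=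
  ⟨hν, memLp_id_two_of_lintegral_lt_top h, hcent⟩

lemma isCenteredL2_of_entranceLaw {ν : ℝ → Measure H}
    (hprob : ∀ s, 0 < s → IsProbabilityMeasure (ν s))
    (hcent : ∀ s, 0 < s → ∫ x, x ∂(ν s) = 0)
    (hadd : ∀ r t, 0 < r → 0 < t → ν (r + t) = (ν r).map (T t))
    (hint : ∀ t : ℝ, 0 ≤ t → ∫⁻ s in Set.Ioo 0 t, ∫⁻ x, (‖x‖₊ : ℝ≥0∞) ^ 2 ∂(ν s) < ⊤)
    {t : ℝ} (ht : 0 < t) : IsCenteredL2 (ν t) := by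
  obtain ⟨s, hs, hfin⟩ : ∃ s ∈ Set.Ioo 0 t, ∫⁻ x, (‖x‖₊ : ℝ≥0∞) ^ 2 ∂(ν s) < ⊤ := by
    by_contra! hcon
    have h1 := hint t ht.le
    rw [setLIntegral_congr_fun measurableSet_Ioo (fun s hs => top_le_iff.1 (hcon s hs))] at h1
    simp [ht] at h1
  have := hprob s hs.1
  have h2 := hadd s (t - s) hs.1 (by linarith [hs.2])
  rw [add_sub_cancel] at h2
  rw [h2]
  exact (isCenteredL2_of_lintegral_lt_top (hcent s hs.1) hfin).map _

lemma setIntegral_Ioo_zero_add {f : ℝ → ℂ} {r t : ℝ} (hr : 0 ≤ r) (ht : 0 ≤ t)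
    (hf : IntegrableOn f (Set.Ioo 0 (r + t))) :
    ∫ s in Set.Ioo 0 (r + t), f s
      = (∫ s in Set.Ioo 0 r, f (s + t)) + ∫ s in Set.Ioo 0 t, f s := by
  have hi : ∀ a b, 0 ≤ a → a ≤ b → b ≤ r + t → IntervalIntegrable f volume a b := by
    intro a b ha hab hb
    rw [intervalIntegrable_iff_integrableOn_Ioo_of_le hab]
    exact hf.mono_set (Set.Ioo_subset_Ioo ha hb)
  rw [← integral_Ioc_eq_integral_Ioo, ← integral_Ioc_eq_integral_Ioo,
    ← integral_Ioc_eq_integral_Ioo, ← intervalIntegral.integral_of_le (by linarith),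
    ← intervalIntegral.integral_of_le hr, ← intervalIntegral.integral_of_le ht,
    intervalIntegral.integral_comp_add_right, zero_add, add_comm (intervalIntegral _ _ _ _),
    intervalIntegral.integral_add_adjacent_intervals (hi 0 t le_rfl ht (by linarith))
      (hi t (r + t) ht (by linarith) le_rfl)]

lemma isSC_of_representation (hT : IsC0 T) {μ : ℝ → Measure H}
    (hμ : ∀ t, 0 ≤ t → IsProbabilityMeasure (μ t)) {ν : ℝ → Measure H} {L : ℝ → H → ℂ}
    (hν : ∀ s, 0 < s → IsCenteredL2 (ν s)) (hdiv : ∀ s, 0 < s → IsInfDiv (ν s))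
    (hadd : ∀ r t, 0 < r → 0 < t → ν (r + t) = (ν r).map (T t))
    (hint : ∀ t : ℝ, 0 ≤ t → ∫⁻ s in Set.Ioo 0 t, ∫⁻ x, (‖x‖₊ : ℝ≥0∞) ^ 2 ∂(ν s) < ⊤)
    (hL : ∀ s, 0 < s → Continuous (L s) ∧ L s 0 = 0 ∧
      ∀ a : H, Complex.exp (L s a) = charFun (ν s) a)
    (hrep : ∀ t : ℝ, 0 ≤ t → ∀ a : H,
      charFun (μ t) a = Complex.exp (∫ s in Set.Ioo 0 t, L s a)) : IsSC T μ := by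
  have hfam : IsExponentFamily T L := by
    refine ⟨fun s hs => isExponent_of_isInfDiv (hν s hs) (hdiv s hs) (hL s hs).1 (hL s hs).2.1
      (hL s hs).2.2, fun s r hs hr a => ?_⟩
    rcases hr.eq_or_lt with rfl | hr
    · simp [hT.1, ContinuousLinearMap.adjoint_id]
    · refine eq_of_exp_eq_of_continuous (hL (s + r) (by positivity)).1
        (g := fun a => L s (ContinuousLinearMap.adjoint (T r) a))
        ((hL s hs).1.comp (ContinuousLinearMap.continuous _)) (fun b => ?_) (x₀ := 0) ?_ a
      · rw [(hL (s + r) (by positivity)).2.2, (hL s hs).2.2, hadd s r hs hr, charFun_map_clm]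
      · simp [(hL (s + r) (by positivity)).2.1, (hL s hs).2.1]
  refine ⟨hμ, fun r t hr ht => ?_⟩
  have := hμ r hr
  have := hμ t ht
  have := hμ (r + t) (by positivity)
  have := Measure.isProbabilityMeasure_map (μ := μ r) (T t).continuous.aemeasurable
  have := isProbabilityMeasure_mconv ((μ r).map (T t)) (μ t)
  apply Measure.ext_of_charFun
  ext a
  have hi := hfam.integrableOn hT hν (fun s hs a => ((hL s hs).2.2 a).symm)
    (hint (r + t) (by positivity)) a
  rw [charFun_mconv, charFun_map_clm, hrep _ (by positivity), hrep r hr, hrep t ht,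
    setIntegral_Ioo_zero_add hr ht hi, Complex.exp_add]
  congr 2
  exact setIntegral_congr_fun measurableSet_Ioo fun s hs => hfam.add_eq s t hs.1 ht a

end Converse

section SkewConvolution

set_option linter.unusedSectionVars false

variable {H : Type*} [NormedAddCommGroup H] [InnerProductSpace ℝ H] [CompleteSpace H]
  [MeasurableSpace H] [BorelSpace H] [SecondCountableTopology H]
  {T : ℝ → H →L[ℝ] H} {μ : ℝ → Measure H}

lemma map_map_clm (ρ : Measure H) (A B : H →L[ℝ] H) : (ρ.map A).map B = ρ.map (B.comp A) := by
  rw [Measure.map_map B.continuous.measurable A.continuous.measurable]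
  rfl

lemma map_id_clm (ρ : Measure H) : ρ.map (ContinuousLinearMap.id ℝ H) = ρ :=
  Measure.map_id

lemma monotone_comp_max {f : ℝ → ℝ} (hf : MonotoneOn f (Set.Ici 0)) :
    Monotone fun t => f (max t 0) :=
  fun _ _ hst => hf (Set.mem_Ici.2 (le_max_right _ _)) (Set.mem_Ici.2 (le_max_right _ _))
    (max_le_max_right 0 hst)

/-- A skew convolution semigroup of centered measures with finite second moments. -/
structure IsCenteredSC (T : ℝ → H →L[ℝ] H) (μ : ℝ → Measure H) : Prop where
  isC0 : IsC0 T
  isCenteredL2 : ∀ t, 0 ≤ t → IsCenteredL2 (μ t)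
  add_eq : ∀ r t, 0 ≤ r → 0 ≤ t → μ (r + t) = mconv ((μ r).map (T t)) (μ t)

namespace IsCenteredSC

variable (h : IsCenteredSC T μ)
include h

lemma charFun_add {r t : ℝ} (hr : 0 ≤ r) (ht : 0 ≤ t) (a : H) :
    charFun (μ (r + t)) a = charFun ((μ r).map (T t)) a * charFun (μ t) a := by
  have := (h.isCenteredL2 t ht).isProb
  have := ((h.isCenteredL2 r hr).map (T t)).isProb
  rw [h.add_eq r t hr ht, charFun_mconv]

lemma secondMoment_map_add {r t : ℝ} (hr : 0 ≤ r) (ht : 0 ≤ t) (A : H →L[ℝ] H) :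
    secondMoment ((μ (r + t)).map A)
      = secondMoment (((μ r).map (T t)).map A) + secondMoment ((μ t).map A) := by
  have h1 := h.isCenteredL2 t ht
  have h2 := (h.isCenteredL2 r hr).map (T t)
  have := h1.isProb
  have := h2.isProb
  rw [h.add_eq r t hr ht, map_mconv, (h2.map A).secondMoment_mconv (h1.map A)]

lemma secondMoment_add {r t : ℝ} (hr : 0 ≤ r) (ht : 0 ≤ t) :
    secondMoment (μ (r + t)) = secondMoment ((μ r).map (T t)) + secondMoment (μ t) := by
  simpa only [map_id_clm] using h.secondMoment_map_add hr ht (ContinuousLinearMap.id ℝ H)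

lemma monotoneOn_secondMoment_map (A : H →L[ℝ] H) :
    MonotoneOn (fun t => secondMoment ((μ t).map A)) (Set.Ici 0) := by
  intro s hs t _ hst
  have h1 := h.secondMoment_map_add (sub_nonneg.2 hst) hs A
  rw [sub_add_cancel] at h1
  simp only [h1]
  linarith [secondMoment_nonneg (((μ (t - s)).map (T s)).map A)]

lemma monotoneOn_secondMoment : MonotoneOn (fun t => secondMoment (μ t)) (Set.Ici 0) := by
  simpa only [map_id_clm] using h.monotoneOn_secondMoment_map (ContinuousLinearMap.id ℝ H)

lemma secondMoment_zero : secondMoment (μ 0) = 0 := by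
  have h1 := h.secondMoment_add le_rfl le_rfl
  rw [h.isC0.1, map_id_clm, add_zero] at h1
  linarith

lemma tendsto_secondMoment_zero :
    Tendsto (fun t => secondMoment (μ t)) (nhdsWithin 0 (Set.Ioi 0)) (nhds 0) := by
  have hmono := h.monotoneOn_secondMoment
  obtain ⟨q, hq⟩ : ∃ q, Tendsto (fun t => secondMoment (μ t)) (nhdsWithin 0 (Set.Ioi 0))
      (nhds q) := by
    refine ⟨_, ((monotone_comp_max hmono).tendsto_nhdsGT 0).congr' ?_⟩
    filter_upwards [self_mem_nhdsWithin] with t ht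
    rw [max_eq_left (le_of_lt ht)]
  have hq0 : 0 ≤ q := ge_of_tendsto' hq fun t => secondMoment_nonneg _
  have hdouble : ∀ s : ℝ, 0 < s → secondMoment (μ s) + q ≤ secondMoment (μ (2 * s)) := by
    intro s hs
    have hc := (h.isC0.continuousOn_secondMoment_map (h.isCenteredL2 s hs.le)) 0 Set.self_mem_Ici
    have hc' : Tendsto (fun t => secondMoment ((μ s).map (T t))) (nhdsWithin 0 (Set.Ioi 0))
        (nhds (secondMoment (μ s))) := by
      have h1 := hc.mono_left (nhdsWithin_mono 0 Set.Ioi_subset_Ici_self)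
      simpa only [h.isC0.1, map_id_clm] using h1
    refine le_of_tendsto (hc'.add hq) ?_
    filter_upwards [Ioo_mem_nhdsGT hs] with t ht
    rw [← h.secondMoment_add hs.le ht.1.le]
    exact hmono (Set.mem_Ici.2 (by linarith [ht.1])) (Set.mem_Ici.2 (by linarith))
      (by linarith [ht.2])
  have hq2 : Tendsto (fun s : ℝ => secondMoment (μ (2 * s))) (nhdsWithin 0 (Set.Ioi 0))
      (nhds q) := by
    refine hq.comp (tendsto_nhdsWithin_iff.2 ⟨?_, ?_⟩)
    · have h1 : Tendsto (fun s : ℝ => 2 * s) (nhds 0) (nhds (2 * 0)) :=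
        (continuous_const_mul 2).tendsto 0
      rw [mul_zero] at h1
      exact h1.mono_left nhdsWithin_le_nhds
    · filter_upwards [self_mem_nhdsWithin] with s hs
      simpa using hs
  have h2 : q + q ≤ q := le_of_tendsto_of_tendsto (hq.add_const q) hq2 (by
    filter_upwards [self_mem_nhdsWithin] with s hs
    exact hdouble s hs)
  rwa [show q = 0 by linarith] at hq

lemma norm_charFun_map_sub_one_le {r t K : ℝ} (hr : 0 ≤ r) (hK : ‖T t‖ ≤ K) (a : H) :
    ‖charFun ((μ r).map (T t)) a - 1‖ ≤ ‖a‖ ^ 2 * (K ^ 2 * secondMoment (μ r)) := by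
  have h1 := h.isCenteredL2 r hr
  refine ((h1.map (T t)).norm_charFun_sub_one_le a).trans ?_
  gcongr
  exact h1.secondMoment_map_le (T t) hK

lemma norm_charFun_add_sub_le {r t : ℝ} (hr : 0 ≤ r) (ht : 0 ≤ t) (a : H) :
    ‖charFun (μ (r + t)) a - charFun (μ t) a‖ ≤ ‖charFun ((μ r).map (T t)) a - 1‖ := by
  have := (h.isCenteredL2 t ht).isProb
  rw [h.charFun_add hr ht, ← sub_one_mul, norm_mul]
  exact mul_le_of_le_one_right (norm_nonneg _) (norm_charFun_le_one a)

lemma norm_charFun_sub_le_secondMoment {s t : ℝ} (hs : 0 ≤ s) (hst : s ≤ t) (a : H) :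
    ‖charFun (μ t) a - charFun (μ s) a‖
      ≤ ‖a‖ ^ 2 * secondMoment (μ t) - ‖a‖ ^ 2 * secondMoment (μ s) := by
  have hr : 0 ≤ t - s := sub_nonneg.2 hst
  have h1 := h.norm_charFun_add_sub_le hr hs a
  have h2 := ((h.isCenteredL2 _ hr).map (T s)).norm_charFun_sub_one_le a
  have h3 := h.secondMoment_add hr hs
  rw [sub_add_cancel] at h1 h3
  refine (h1.trans h2).trans (le_of_eq ?_)
  rw [h3]
  ring

lemma charFun_zero_time (a : H) : charFun (μ 0) a = 1 := by
  have h1 := (h.isCenteredL2 0 le_rfl).norm_charFun_sub_one_le a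
  rw [h.secondMoment_zero, mul_zero] at h1
  exact sub_eq_zero.1 (norm_le_zero_iff.1 h1)

lemma charFun_ne_zero {t : ℝ} (ht : 0 ≤ t) (a : H) : charFun (μ t) a ≠ 0 := by
  rcases ht.eq_or_lt with rfl | htpos
  · rw [h.charFun_zero_time]
    exact one_ne_zero
  obtain ⟨K, hK1, hK⟩ := h.isC0.exists_norm_le t
  have hlim : Tendsto (fun n : ℕ => ‖a‖ ^ 2 * (K ^ 2 * secondMoment (μ (t * (1 / ((n : ℝ) + 1))))))
      atTop (nhds (‖a‖ ^ 2 * (K ^ 2 * 0))) := by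
    refine ((h.tendsto_secondMoment_zero.comp
      (tendsto_nhdsWithin_iff.2 ⟨?_, ?_⟩)).const_mul _).const_mul _
    · simpa using (tendsto_one_div_add_atTop_nhds_zero_nat (𝕜 := ℝ)).const_mul t
    · refine Eventually.of_forall fun n => ?_
      simp only [Set.mem_Ioi]
      positivity
  rw [mul_zero, mul_zero] at hlim
  obtain ⟨n, hn⟩ := (hlim.eventually (gt_mem_nhds zero_lt_one)).exists
  set d := t * (1 / ((n : ℝ) + 1)) with hd
  have hdpos : 0 < d := by positivity
  have hnd : ((n + 1 : ℕ) : ℝ) * d = t := by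
    rw [hd]
    push_cast
    field_simp
  have key : ∀ k : ℕ, k ≤ n + 1 → charFun (μ (k * d)) a ≠ 0 := by
    intro k
    induction k with
    | zero =>
      intro _
      simp [h.charFun_zero_time]
    | succ k ih =>
      intro hk
      have hkd : 0 ≤ (k : ℝ) * d := by positivity
      have h1 := h.norm_charFun_map_sub_one_le hdpos.le (hK (k * d) ⟨hkd, by
        rw [← hnd]
        gcongr
        omega⟩) a
      rw [show ((k + 1 : ℕ) : ℝ) * d = d + k * d by push_cast; ring, h.charFun_add hdpos.le hkd]
      refine mul_ne_zero (fun h0 => ?_) (ih (by omega))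
      rw [h0] at h1
      norm_num at h1
      linarith
  have := key (n + 1) le_rfl
  rwa [hnd] at this

lemma continuousOn_charFun (a : H) : ContinuousOn (fun t => charFun (μ t) a) (Set.Ici 0) := by
  intro s hs
  have hs0 : 0 ≤ s := hs
  obtain ⟨K, hK1, hK⟩ := h.isC0.exists_norm_le (s + 1)
  have hF : Tendsto (fun t => secondMoment (μ |t - s|)) (nhds s) (nhds 0) := by
    have h1 : Tendsto (fun t => secondMoment (μ t)) (nhdsWithin 0 (Set.Ici 0)) (nhds 0) := by
      rw [← Set.Ioi_insert, nhdsWithin_insert]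
      refine Tendsto.sup ?_ h.tendsto_secondMoment_zero
      rw [tendsto_pure_left]
      intro U hU
      rw [h.secondMoment_zero]
      exact mem_of_mem_nhds hU
    refine h1.comp (tendsto_nhdsWithin_iff.2 ⟨?_, 
      Eventually.of_forall fun t => Set.mem_Ici.2 (abs_nonneg _)⟩)
    have h2 : Tendsto (fun t : ℝ => |t - s|) (nhds s) (nhds |s - s|) :=
      (continuous_abs.comp (continuous_sub_right s)).tendsto s
    simpa using h2
  rw [ContinuousWithinAt, tendsto_iff_norm_sub_tendsto_zero]
  have hlim := ((hF.const_mul (K ^ 2)).const_mul (‖a‖ ^ 2)).mono_left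
    (nhdsWithin_le_nhds (s := Set.Ici 0))
  rw [mul_zero, mul_zero] at hlim
  refine squeeze_zero' (Eventually.of_forall fun t => norm_nonneg _) ?_ hlim
  filter_upwards [self_mem_nhdsWithin, mem_nhdsWithin_of_mem_nhds
    (Iio_mem_nhds (show s < s + 1 by linarith))] with t ht ht1
  have ht0 : 0 ≤ t := ht
  have ht1' : t < s + 1 := ht1
  have haux : ∀ u v, 0 ≤ u → u ≤ v → v ≤ s + 1 →
      ‖charFun (μ v) a - charFun (μ u) a‖ ≤ ‖a‖ ^ 2 * (K ^ 2 * secondMoment (μ (v - u))) := by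
    intro u v hu huv hv
    have h1 := h.norm_charFun_add_sub_le (sub_nonneg.2 huv) hu a
    rw [sub_add_cancel] at h1
    exact h1.trans (h.norm_charFun_map_sub_one_le (sub_nonneg.2 huv) (hK u ⟨hu, huv.trans hv⟩) a)
  rcases le_total s t with hst | hst
  · rw [abs_of_nonneg (sub_nonneg.2 hst)]
    exact haux s t hs0 hst ht1'.le
  · rw [abs_of_nonpos (sub_nonpos.2 hst), norm_sub_rev, neg_sub]
    exact haux t s ht0 hst (by linarith)

end IsCenteredSC

end SkewConvolution

section MonotoneDerivative

lemma deriv_nonneg_of_monotoneOn {f : ℝ → ℝ} (hf : MonotoneOn f (Set.Ici 0)) {s : ℝ}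
    (hs : 0 < s) : 0 ≤ deriv f s := by
  have h1 : f =ᶠ[nhds s] fun t => f (max t 0) := by
    filter_upwards [Ioi_mem_nhds hs] with t ht
    rw [max_eq_left (le_of_lt ht)]
  rw [h1.deriv_eq]
  exact (monotone_comp_max hf).deriv_nonneg

lemma lintegral_deriv_le {f : ℝ → ℝ} (hf : MonotoneOn f (Set.Ici 0)) (hf0 : 0 ≤ f 0) {t : ℝ}
    (ht : 0 ≤ t) :
    ∫⁻ s in Set.Ioo 0 t, ENNReal.ofReal (deriv f s) ≤ ENNReal.ofReal (f t) := by
  have hm : MonotoneOn f (Set.uIcc 0 t) := by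
    rw [Set.uIcc_of_le ht]
    exact hf.mono Set.Icc_subset_Ici_self
  have h1 := hm.intervalIntegral_deriv_mem_uIcc
  have h2 := hm.intervalIntegrable_deriv
  rw [intervalIntegrable_iff_integrableOn_Ioo_of_le ht] at h2
  rw [intervalIntegral.integral_of_le ht, integral_Ioc_eq_integral_Ioo,
    Set.uIcc_of_le (sub_nonneg.2 (hf Set.self_mem_Ici ht ht))] at h1
  rw [← ofReal_integral_eq_lintegral_ofReal h2
    ((ae_restrict_mem measurableSet_Ioo).mono fun s hs => deriv_nonneg_of_monotoneOn hf hs.1)]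
  exact ENNReal.ofReal_le_ofReal (h1.2.trans (by linarith))

lemma ae_differentiableAt_of_monotoneOn {f : ℝ → ℝ} (hf : MonotoneOn f (Set.Ici 0)) :
    ∀ᵐ s ∂volume.restrict (Set.Ioi 0), DifferentiableAt ℝ f s := by
  filter_upwards [(hf.mono Set.Ioi_subset_Ici_self).ae_differentiableWithinAt measurableSet_Ioi,
    ae_restrict_mem measurableSet_Ioi] with s h1 h2
  exact h1.differentiableAt (Ioi_mem_nhds h2)

lemma ae_differentiableAt_of_norm_sub_le {g : ℝ → ℂ} {F : ℝ → ℝ}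
    (hF : MonotoneOn F (Set.Ici 0))
    (hg : ∀ s t, 0 ≤ s → s ≤ t → ‖g t - g s‖ ≤ F t - F s) :
    ∀ᵐ s ∂volume.restrict (Set.Ioi 0), DifferentiableAt ℝ g s := by
  have hre : MonotoneOn (fun t => (g t).re + F t) (Set.Ici 0) := by
    intro s hs t _ hst
    have h1 := (Complex.abs_re_le_norm _).trans (hg s t hs hst)
    rw [Complex.sub_re] at h1
    simp only
    linarith [(abs_le.1 h1).1]
  have him : MonotoneOn (fun t => (g t).im + F t) (Set.Ici 0) := by
    intro s hs t _ hst
    have h1 := (Complex.abs_im_le_norm _).trans (hg s t hs hst)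
    rw [Complex.sub_im] at h1
    simp only
    linarith [(abs_le.1 h1).1]
  filter_upwards [ae_differentiableAt_of_monotoneOn hF, ae_differentiableAt_of_monotoneOn hre,
    ae_differentiableAt_of_monotoneOn him] with s h1 h2 h3
  have h4 : DifferentiableAt ℝ (fun t => (g t).re) s := by
    refine (h2.sub h1).congr_of_eventuallyEq (Eventually.of_forall fun t => ?_)
    simp
  have h5 : DifferentiableAt ℝ (fun t => (g t).im) s := by
    refine (h3.sub h1).congr_of_eventuallyEq (Eventually.of_forall fun t => ?_)
    simp
  have h6 : DifferentiableAt ℝ (fun t => ((g t).re : ℂ) + ((g t).im : ℂ) * Complex.I) s :=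
    ((Complex.ofRealCLM.differentiableAt.comp s h4).add
      ((Complex.ofRealCLM.differentiableAt.comp s h5).mul_const Complex.I))
  simpa only [Complex.re_add_im] using h6

lemma ae_exists_deriv_lt {f : ℕ → ℝ → ℝ} (hf : ∀ N, MonotoneOn (f N) (Set.Ici 0))
    (hf0 : ∀ N, 0 ≤ f N 0) (hlim : ∀ t, 0 ≤ t → Tendsto (fun N => f N t) atTop (nhds 0)) :
    ∀ᵐ s ∂volume.restrict (Set.Ioi (0 : ℝ)), ∀ ε > 0, ∃ N, deriv (f N) s < ε := by
  have hU : Set.Ioi (0 : ℝ) = ⋃ k : ℕ, Set.Ioo 0 (k : ℝ) := by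
    ext s
    simp only [Set.mem_Ioi, Set.mem_iUnion, Set.mem_Ioo]
    exact ⟨fun hs => (exists_nat_gt s).imp fun k hk => ⟨hs, hk⟩, fun ⟨k, hk⟩ => hk.1⟩
  rw [hU, ae_restrict_iUnion_iff]
  intro k
  have hz : ∫⁻ s in Set.Ioo 0 (k : ℝ), ⨅ N, ENNReal.ofReal (deriv (f N) s) = 0 := by
    refine le_antisymm (ge_of_tendsto' (f := fun N => ENNReal.ofReal (f N k)) (x := atTop) ?_
      fun N => ?_) zero_le
    · simpa using ENNReal.tendsto_ofReal (hlim k k.cast_nonneg)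
    · exact (lintegral_mono fun s => iInf_le _ N).trans
        (lintegral_deriv_le (hf N) (hf0 N) k.cast_nonneg)
  rw [lintegral_eq_zero_iff (Measurable.iInf fun N => (measurable_deriv _).ennreal_ofReal)] at hz
  filter_upwards [hz] with s hs ε hε
  have h1 : ⨅ N, ENNReal.ofReal (deriv (f N) s) < ENNReal.ofReal ε := by
    rw [hs]
    simpa using hε
  obtain ⟨N, hN⟩ := iInf_lt_iff.1 h1
  exact ⟨N, (ENNReal.ofReal_lt_ofReal_iff hε).1 hN⟩

end MonotoneDerivative

section RegularTimes

set_option linter.unusedSectionVars false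

variable {H : Type*} [NormedAddCommGroup H] [InnerProductSpace ℝ H] [CompleteSpace H]
  [MeasurableSpace H] [BorelSpace H] [SecondCountableTopology H]
  {T : ℝ → H →L[ℝ] H} {μ : ℝ → Measure H} {Q : ℕ → H →L[ℝ] H} {s : ℝ}

lemma IsTailSequence.tendsto_secondMoment_map (hQ : IsTailSequence Q) {ρ : Measure H}
    (hρ : IsCenteredL2 ρ) :
    Tendsto (fun N => secondMoment (ρ.map (Q N))) atTop (nhds 0) := by
  simp only [IsCenteredL2.secondMoment_map]
  have h1 := tendsto_integral_of_dominated_convergence (μ := ρ) (F := fun N x => ‖Q N x‖ ^ 2)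
    (f := fun _ => (0 : ℝ)) (fun x => ‖x‖ ^ 2) (fun N => by fun_prop) hρ.integrable_sq
    (fun N => ae_of_all _ fun x => by
      rw [norm_pow, norm_norm]
      exact pow_le_pow_left₀ (norm_nonneg _) (hQ.norm_le N x) 2)
    (ae_of_all _ fun x => by simpa using (hQ.tendsto_zero x).norm.pow 2)
  simpa using h1

/-- Times at which the characteristic functions and the second moments are differentiable, with
a small derivative of the tails of the second moments. -/
structure IsRegularTime (Q : ℕ → H →L[ℝ] H) (μ : ℝ → Measure H) (s : ℝ) : Prop where
  pos : 0 < s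
  differentiableAt : DifferentiableAt ℝ (fun t => secondMoment (μ t)) s
  differentiableAt_charFun : ∀ n,
    DifferentiableAt ℝ (fun t => charFun (μ t) (TopologicalSpace.denseSeq H n)) s
  tail : ∀ ε > 0, ∃ N, DifferentiableAt ℝ (fun t => secondMoment ((μ t).map (Q N))) s ∧
    deriv (fun t => secondMoment ((μ t).map (Q N))) s < ε

lemma IsCenteredSC.ae_isRegularTime (h : IsCenteredSC T μ) (hQ : IsTailSequence Q) :
    ∀ᵐ s ∂volume.restrict (Set.Ioi 0), IsRegularTime Q μ s := by
  have h1 := ae_differentiableAt_of_monotoneOn h.monotoneOn_secondMoment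
  have h2 : ∀ᵐ s ∂volume.restrict (Set.Ioi 0), ∀ n,
      DifferentiableAt ℝ (fun t => charFun (μ t) (TopologicalSpace.denseSeq H n)) s := by
    refine ae_all_iff.2 fun n => ae_differentiableAt_of_norm_sub_le ?_ fun s t hs hst =>
      h.norm_charFun_sub_le_secondMoment hs hst _
    exact fun s hs t ht hst =>
      mul_le_mul_of_nonneg_left (h.monotoneOn_secondMoment hs ht hst) (by positivity)
  have h3 : ∀ᵐ s ∂volume.restrict (Set.Ioi 0), ∀ N,
      DifferentiableAt ℝ (fun t => secondMoment ((μ t).map (Q N))) s :=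
    ae_all_iff.2 fun N => ae_differentiableAt_of_monotoneOn (h.monotoneOn_secondMoment_map _)
  have h4 := ae_exists_deriv_lt (fun N => h.monotoneOn_secondMoment_map (Q N))
    (fun N => secondMoment_nonneg _)
    (fun t ht => hQ.tendsto_secondMoment_map (h.isCenteredL2 t ht))
  filter_upwards [h1, h2, h3, h4, ae_restrict_mem measurableSet_Ioi] with s k1 k2 k3 k4 k5
  exact ⟨k5, k1, k2, fun ε hε => (k4 ε hε).imp fun N hN => ⟨k3 N, hN⟩⟩

lemma exists_mem_Ioo_of_ae_restrict {p : ℝ → Prop}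
    (hp : ∀ᵐ s ∂volume.restrict (Set.Ioi (0 : ℝ)), p s) {t : ℝ} (ht : 0 < t) :
    ∃ s ∈ Set.Ioo 0 t, p s := by
  have h1 : ∀ᵐ s ∂volume.restrict (Set.Ioo 0 t), p s :=
    ae_restrict_of_ae_restrict_of_subset Set.Ioo_subset_Ioi_self hp
  have : NeZero (volume.restrict (Set.Ioo 0 t)) := ⟨by simp [ht]⟩
  obtain ⟨s, hs⟩ := ((ae_restrict_mem measurableSet_Ioo).and h1).exists
  exact ⟨s, hs⟩

end RegularTimes

section LogDensity

set_option linter.unusedSectionVars false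

variable {H : Type*} [NormedAddCommGroup H] [InnerProductSpace ℝ H] [CompleteSpace H]
  [MeasurableSpace H] [BorelSpace H] [SecondCountableTopology H]
  {T : ℝ → H →L[ℝ] H} {μ : ℝ → Measure H} {Q : ℕ → H →L[ℝ] H} {s : ℝ}

/-- The difference quotient at time `s` of the logarithm of the characteristic function. -/
def logQuotient (T : ℝ → H →L[ℝ] H) (μ : ℝ → Measure H) (s : ℝ) (a : H) (r : ℝ) : ℂ :=
  (charFun ((μ r).map (T s)) a - 1) / r

/-- The right derivative at time `s` of the logarithm of the characteristic function. -/
def logDensity (T : ℝ → H →L[ℝ] H) (μ : ℝ → Measure H) (s : ℝ) (a : H) : ℂ :=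
  limUnder (nhdsWithin 0 (Set.Ioi 0)) (logQuotient T μ s a)

namespace IsCenteredSC

variable (h : IsCenteredSC T μ)
include h

lemma secondMoment_map_map_eq {r : ℝ} (hr : 0 ≤ r) (hs : 0 ≤ s) (A : H →L[ℝ] H) :
    secondMoment (((μ r).map (T s)).map A)
      = secondMoment ((μ (s + r)).map A) - secondMoment ((μ s).map A) := by
  rw [add_comm s r, h.secondMoment_map_add hr hs, add_sub_cancel_right]

lemma tendsto_inv_mul_secondMoment_map (hs : 0 ≤ s) {A : H →L[ℝ] H}
    (hA : DifferentiableAt ℝ (fun t => secondMoment ((μ t).map A)) s) :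
    Tendsto (fun r => r⁻¹ * secondMoment (((μ r).map (T s)).map A)) (nhdsWithin 0 (Set.Ioi 0))
      (nhds (deriv (fun t => secondMoment ((μ t).map A)) s)) := by
  refine hA.hasDerivAt.tendsto_slope_zero_right.congr' ?_
  filter_upwards [self_mem_nhdsWithin] with r hr
  rw [h.secondMoment_map_map_eq (le_of_lt hr) hs, smul_eq_mul]

lemma tendsto_inv_mul_secondMoment (hs : 0 ≤ s)
    (hd : DifferentiableAt ℝ (fun t => secondMoment (μ t)) s) :
    Tendsto (fun r => r⁻¹ * secondMoment ((μ r).map (T s))) (nhdsWithin 0 (Set.Ioi 0))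
      (nhds (deriv (fun t => secondMoment (μ t)) s)) := by
  simpa only [map_id_clm] using h.tendsto_inv_mul_secondMoment_map hs
    (A := ContinuousLinearMap.id ℝ H) (by simpa only [map_id_clm] using hd)

lemma norm_logQuotient_sub_le {r : ℝ} (hr : 0 < r) (a b : H) :
    ‖logQuotient T μ s a r - logQuotient T μ s b r‖
      ≤ ‖a - b‖ * (‖a‖ + ‖b‖) * (r⁻¹ * secondMoment ((μ r).map (T s))) := by
  have h1 := ((h.isCenteredL2 r hr.le).map (T s)).norm_charFun_sub_le a b
  rw [logQuotient, logQuotient, ← sub_div, sub_sub_sub_cancel_right, norm_div,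
    Complex.norm_real, Real.norm_of_nonneg hr.le, div_le_iff₀ hr]
  refine h1.trans (le_of_eq ?_)
  field_simp

lemma charFun_mul_logQuotient {r : ℝ} (hr : 0 ≤ r) (hs : 0 ≤ s) (a : H) :
    charFun (μ s) a * logQuotient T μ s a r
      = r⁻¹ • (charFun (μ (s + r)) a - charFun (μ s) a) := by
  rw [add_comm s r, h.charFun_add hr hs, logQuotient, Complex.real_smul, Complex.ofReal_inv]
  ring

lemma exists_tendsto_logQuotient_denseSeq (hs : IsRegularTime Q μ s) (n : ℕ) :
    ∃ l, Tendsto (logQuotient T μ s (TopologicalSpace.denseSeq H n))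
      (nhdsWithin 0 (Set.Ioi 0)) (nhds l) := by
  have h0 := h.charFun_ne_zero hs.pos.le (TopologicalSpace.denseSeq H n)
  refine ⟨_, (((hs.differentiableAt_charFun n).hasDerivAt.tendsto_slope_zero_right).const_mul
    (charFun (μ s) (TopologicalSpace.denseSeq H n))⁻¹).congr' ?_⟩
  filter_upwards [self_mem_nhdsWithin] with r hr
  rw [← h.charFun_mul_logQuotient (le_of_lt hr) hs.pos.le, inv_mul_cancel_left₀ h0]

lemma exists_tendsto_logQuotient_of_isRegularTime (hs : IsRegularTime Q μ s) (a : H) :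
    ∃ l, Tendsto (logQuotient T μ s a) (nhdsWithin 0 (Set.Ioi 0)) (nhds l) := by
  set D := deriv (fun t => secondMoment (μ t)) s
  have hD0 : 0 ≤ D := deriv_nonneg_of_monotoneOn h.monotoneOn_secondMoment hs.pos
  have hD : ∀ᶠ r in nhdsWithin 0 (Set.Ioi 0), r⁻¹ * secondMoment ((μ r).map (T s)) < D + 1 :=
    (h.tendsto_inv_mul_secondMoment hs.pos.le hs.differentiableAt).eventually_lt_const
      (lt_add_one D)
  refine cauchy_map_iff_exists_tendsto.1 (Metric.cauchy_iff.2 ⟨inferInstance, fun ε hε => ?_⟩)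
  have h1 : ∀ᶠ b in nhds a, ‖a - b‖ * (‖a‖ + ‖b‖) * (D + 1) < ε / 4 := by
    have h2 : Continuous fun b : H => ‖a - b‖ * (‖a‖ + ‖b‖) * (D + 1) := by fun_prop
    exact (h2.tendsto a).eventually_lt_const (by simpa using hε)
  obtain ⟨n, hn⟩ := (TopologicalSpace.denseRange_denseSeq H).mem_nhds h1
  obtain ⟨l, hl⟩ := h.exists_tendsto_logQuotient_denseSeq hs n
  refine ⟨Metric.ball l (ε / 2), ?_, fun x hx y hy => ?_⟩
  · rw [mem_map]
    filter_upwards [hD, Metric.tendsto_nhds.1 hl (ε / 4) (by positivity), self_mem_nhdsWithin]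
      with r k1 k2 k3
    have k4 := h.norm_logQuotient_sub_le (s := s) k3 a (TopologicalSpace.denseSeq H n)
    have k5 := k4.trans_lt ((mul_le_mul_of_nonneg_left k1.le (by positivity)).trans_lt hn)
    rw [Set.mem_preimage, Metric.mem_ball]
    rw [← dist_eq_norm] at k5
    linarith [dist_triangle (logQuotient T μ s a r)
      (logQuotient T μ s (TopologicalSpace.denseSeq H n) r) l]
  · rw [Metric.mem_ball] at hx hy
    linarith [dist_triangle_right x y l]

lemma logQuotient_add {u r : ℝ} (hs : 0 ≤ s) (hu : 0 ≤ u) (a : H) :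
    logQuotient T μ (s + u) a r = logQuotient T μ s (ContinuousLinearMap.adjoint (T u) a) r := by
  rw [logQuotient, logQuotient, ← charFun_map_clm, map_map_clm, add_comm s u,
    h.isC0.2.1 u s hu hs]

lemma tendsto_logQuotient (hs : 0 < s) (a : H) :
    Tendsto (logQuotient T μ s a) (nhdsWithin 0 (Set.Ioi 0)) (nhds (logDensity T μ s a)) := by
  obtain ⟨Q, hQ⟩ := exists_isTailSequence (H := H)
  obtain ⟨u, hu, hreg⟩ := exists_mem_Ioo_of_ae_restrict (h.ae_isRegularTime hQ) hs
  obtain ⟨l, hl⟩ := h.exists_tendsto_logQuotient_of_isRegularTime hreg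
    (ContinuousLinearMap.adjoint (T (s - u)) a)
  refine tendsto_nhds_limUnder ⟨l, hl.congr fun r => ?_⟩
  rw [← h.logQuotient_add hu.1.le (sub_nonneg.2 hu.2.le), add_sub_cancel]

lemma logDensity_add {u : ℝ} (hs : 0 < s) (hu : 0 ≤ u) (a : H) :
    logDensity T μ (s + u) a = logDensity T μ s (ContinuousLinearMap.adjoint (T u) a) :=
  tendsto_nhds_unique (h.tendsto_logQuotient (by linarith) a)
    ((h.tendsto_logQuotient hs _).congr fun _ => (h.logQuotient_add hs.le hu a).symm)

lemma logDensity_zero (hs : 0 < s) : logDensity T μ s 0 = 0 := by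
  refine tendsto_nhds_unique (h.tendsto_logQuotient hs 0) (tendsto_const_nhds.congr' ?_)
  filter_upwards [self_mem_nhdsWithin] with r hr
  have := ((h.isCenteredL2 r (le_of_lt hr)).map (T s)).isProb
  simp [logQuotient]

lemma norm_logDensity_sub_le (hs : IsRegularTime Q μ s) (a b : H) :
    ‖logDensity T μ s a - logDensity T μ s b‖
      ≤ ‖a - b‖ * (‖a‖ + ‖b‖) * deriv (fun t => secondMoment (μ t)) s := by
  refine le_of_tendsto_of_tendsto
    ((h.tendsto_logQuotient hs.pos a).sub (h.tendsto_logQuotient hs.pos b)).norm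
    ((h.tendsto_inv_mul_secondMoment hs.pos.le hs.differentiableAt).const_mul _) ?_
  filter_upwards [self_mem_nhdsWithin] with r hr
  exact h.norm_logQuotient_sub_le hr a b

lemma continuous_logDensity (hs : IsRegularTime Q μ s) : Continuous (logDensity T μ s) := by
  refine continuous_iff_continuousAt.2 fun a => tendsto_iff_norm_sub_tendsto_zero.2 ?_
  have h1 : Continuous fun b : H =>
      ‖b - a‖ * (‖b‖ + ‖a‖) * deriv (fun t => secondMoment (μ t)) s := by fun_prop
  have h2 := h1.tendsto a
  simp only [sub_self, norm_zero, zero_mul] at h2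
  exact squeeze_zero (fun b => norm_nonneg _) (fun b => h.norm_logDensity_sub_le hs b a) h2

end IsCenteredSC

end LogDensity

section RegularExponent

set_option linter.unusedSectionVars false

variable {H : Type*} [NormedAddCommGroup H] [InnerProductSpace ℝ H] [CompleteSpace H]
  [MeasurableSpace H] [BorelSpace H] [SecondCountableTopology H]
  {T : ℝ → H →L[ℝ] H} {μ : ℝ → Measure H} {Q : ℕ → H →L[ℝ] H} {s : ℝ}

lemma IsTailSequence.secondMoment_map_anti (hQ : IsTailSequence Q) {ρ : Measure H}
    (hρ : IsCenteredL2 ρ) {N M : ℕ} (hNM : N ≤ M) :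
    secondMoment (ρ.map (Q M)) ≤ secondMoment (ρ.map (Q N)) := by
  rw [IsCenteredL2.secondMoment_map, IsCenteredL2.secondMoment_map]
  have h1 := (hρ.map (Q N)).integrable_sq
  rw [integrable_map_measure (by fun_prop) (by fun_prop)] at h1
  have h2 := (hρ.map (Q M)).integrable_sq
  rw [integrable_map_measure (by fun_prop) (by fun_prop)] at h2
  exact integral_mono h2 h1 fun x => pow_le_pow_left₀ (norm_nonneg _) (hQ.antitone N M x hNM) 2

namespace IsCenteredSC

variable (h : IsCenteredSC T μ)
include h

lemma exists_inv_mul_secondMoment_map_le (hQ : IsTailSequence Q) (hs : IsRegularTime Q μ s)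
    {ε : ℝ} (hε : 0 < ε) :
    ∃ N, ∀ r, 0 < r → r ≤ 1 → r⁻¹ * secondMoment (((μ r).map (T s)).map (Q N)) ≤ ε := by
  obtain ⟨N, hN, hlt⟩ := hs.tail ε hε
  obtain ⟨δ, hδ, hsub⟩ := mem_nhdsGT_iff_exists_Ioo_subset.1
    ((h.tendsto_inv_mul_secondMoment_map hs.pos.le hN).eventually_lt_const hlt)
  have hδ0 : 0 < δ := hδ
  have hs1 : 0 ≤ s + 1 := by linarith [hs.pos]
  have hlim := (hQ.tendsto_secondMoment_map (h.isCenteredL2 (s + 1) hs1)).const_mul δ⁻¹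
  rw [mul_zero] at hlim
  obtain ⟨M, hM, hNM⟩ := ((hlim.eventually_le_const hε).and (eventually_ge_atTop N)).exists
  refine ⟨M, fun r hr hr1 => ?_⟩
  rcases lt_or_ge r δ with hrδ | hrδ
  · refine le_trans ?_ (le_of_lt (hsub ⟨hr, hrδ⟩))
    exact mul_le_mul_of_nonneg_left
      (hQ.secondMoment_map_anti ((h.isCenteredL2 r hr.le).map (T s)) hNM) (by positivity)
  · refine le_trans ?_ hM
    refine mul_le_mul (inv_anti₀ hδ0 hrδ) ?_ (secondMoment_nonneg _) (by positivity)
    rw [h.secondMoment_map_map_eq hr.le hs.pos.le]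
    have h1 := h.monotoneOn_secondMoment_map (Q M) (Set.mem_Ici.2 (by linarith [hs.pos]))
      (Set.mem_Ici.2 hs1) (by linarith : s + r ≤ s + 1)
    simp only at h1
    linarith [secondMoment_nonneg ((μ s).map (Q M))]

lemma exists_root_logDensity (hQ : IsTailSequence Q) (hs : IsRegularTime Q μ s) {m : ℕ}
    (hm : m ≠ 0) :
    ∃ ρ, IsCenteredL2 ρ ∧ (∀ a, charFun ρ a = Complex.exp (logDensity T μ s a / m)) ∧
      secondMoment ρ ≤ deriv (fun t => secondMoment (μ t)) s / m := by
  have hm0 : (0 : ℝ) < m := by exact_mod_cast Nat.pos_of_ne_zero hm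
  have hm1 : (1 : ℝ) ≤ m := by exact_mod_cast Nat.one_le_iff_ne_zero.2 hm
  set r : ℕ → ℝ := fun k => ((m : ℝ) * k)⁻¹ with hr
  have hr0 : ∀ n : ℕ, 0 < r (n + 1) := fun n => by positivity
  have hr1 : ∀ n : ℕ, r (n + 1) ≤ 1 := fun n => inv_le_one_of_one_le₀ (by
    push_cast
    nlinarith [n.cast_nonneg (α := ℝ)])
  have hrm : ∀ n : ℕ, ((n + 1 : ℕ) : ℝ) = (r (n + 1))⁻¹ / m := fun n => by
    simp only [hr, inv_inv]
    field_simp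
  have hrlim : Tendsto (fun n => r (n + 1)) atTop (nhdsWithin 0 (Set.Ioi 0)) := by
    refine tendsto_nhdsWithin_iff.2 ⟨?_, Eventually.of_forall hr0⟩
    refine (tendsto_add_atTop_iff_nat 1).2 ?_
    exact tendsto_inv_atTop_zero.comp (tendsto_natCast_atTop_atTop.const_mul_atTop hm0)
  have hκ : ∀ n, IsCenteredL2 ((μ (r (n + 1))).map (T s)) := fun n =>
    (h.isCenteredL2 _ (hr0 n).le).map (T s)
  set ρ : ℕ → Measure H := fun n => convPow ((μ (r (n + 1))).map (T s)) (n + 1) with hρ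
  have hρL2 : ∀ n, IsCenteredL2 (ρ n) := fun n => (hκ n).convPow (n + 1)
  have hsm : ∀ n, secondMoment (ρ n)
      = (r (n + 1))⁻¹ * secondMoment ((μ (r (n + 1))).map (T s)) / m := fun n => by
    rw [hρ, (hκ n).secondMoment_convPow, hrm]
    ring
  have hD : Tendsto (fun n => secondMoment (ρ n)) atTop
      (nhds (deriv (fun t => secondMoment (μ t)) s / m)) := by
    simp only [hsm]
    exact ((h.tendsto_inv_mul_secondMoment hs.pos.le hs.differentiableAt).comp hrlim).div_const _
  obtain ⟨D, hDb⟩ := hD.bddAbove_range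
  have htight : IsTightMeasureSet (Set.range ρ) := by
    refine isTightMeasureSet_of_tail (D := D) hQ ?_ ?_ fun ε hε => ?_
    · rintro _ ⟨n, rfl⟩
      exact hρL2 n
    · rintro _ ⟨n, rfl⟩
      exact hDb ⟨n, rfl⟩
    · obtain ⟨N, hN⟩ := h.exists_inv_mul_secondMoment_map_le hQ hs hε
      refine ⟨N, ?_⟩
      rintro _ ⟨n, rfl⟩
      have := (hκ n).isProb
      rw [hρ, map_convPow, ((hκ n).map (Q N)).secondMoment_convPow, hrm, div_mul_eq_mul_div,
        div_le_iff₀ hm0]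
      nlinarith [hN _ (hr0 n) (hr1 n)]
  have hcf : ∀ a, Tendsto (fun n => charFun (ρ n) a) atTop
      (nhds (Complex.exp (logDensity T μ s a / m))) := by
    intro a
    have h1 : Tendsto (fun k : ℕ => (k : ℂ) * (r k * logQuotient T μ s a (r k))) atTop
        (nhds (logDensity T μ s a / m)) := by
      refine (tendsto_add_atTop_iff_nat 1).1 ?_
      refine (((h.tendsto_logQuotient hs.pos a).comp hrlim).div_const (m : ℂ)).congr fun n => ?_
      have h2 : (((n + 1 : ℕ) : ℝ) : ℂ) = ((((r (n + 1))⁻¹ / m : ℝ)) : ℂ) := by rw [hrm]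
      have h3 : (r (n + 1) : ℂ) ≠ 0 := by exact_mod_cast (hr0 n).ne'
      rw [Complex.ofReal_natCast] at h2
      rw [h2]
      push_cast
      simp only [Function.comp_apply]
      field_simp
    refine ((tendsto_add_atTop_iff_nat 1).2
      (Complex.tendsto_one_add_pow_exp_of_tendsto h1)).congr fun n => ?_
    have := (hκ n).isProb
    have h3 : (r (n + 1) : ℂ) ≠ 0 := by exact_mod_cast (hr0 n).ne'
    rw [hρ, charFun_convPow, logQuotient, mul_div_cancel₀ _ h3, add_sub_cancel]
  obtain ⟨ν, k1, k2, k3⟩ := exists_isCenteredL2_charFun_eq hρL2 htight hD hcf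
  exact ⟨ν, k1, fun a => congrFun k2 a, k3⟩

lemma isExponent_logDensity_of_isRegularTime (hQ : IsTailSequence Q)
    (hs : IsRegularTime Q μ s) : IsExponent (logDensity T μ s) where
  continuous := h.continuous_logDensity hs
  map_zero := h.logDensity_zero hs.pos
  exists_root _ hm := (h.exists_root_logDensity hQ hs hm).imp fun _ hρ => ⟨hρ.1, hρ.2.1⟩

lemma isExponentFamily_logDensity : IsExponentFamily T (logDensity T μ) where
  isExponent s hs := by
    obtain ⟨Q, hQ⟩ := exists_isTailSequence (H := H)
    obtain ⟨u, hu, hreg⟩ := exists_mem_Ioo_of_ae_restrict (h.ae_isRegularTime hQ) hs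
    have h1 := (h.isExponent_logDensity_of_isRegularTime hQ hreg).comp_adjoint (T (s - u))
    have h2 := fun a => h.logDensity_add hu.1 (sub_nonneg.2 hu.2.le) a
    rw [add_sub_cancel] at h2
    rwa [funext h2]
  add_eq s r hs hr a := h.logDensity_add hs hr a

lemma ae_secondMoment_le {ν : ℝ → Measure H} (hν : ∀ s, 0 < s → IsCenteredL2 (ν s))
    (hexp : ∀ s, 0 < s → ∀ a, charFun (ν s) a = Complex.exp (logDensity T μ s a)) :
    ∀ᵐ s ∂volume.restrict (Set.Ioi 0),
      secondMoment (ν s) ≤ deriv (fun t => secondMoment (μ t)) s := by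
  obtain ⟨Q, hQ⟩ := exists_isTailSequence (H := H)
  filter_upwards [h.ae_isRegularTime hQ] with s hs
  obtain ⟨ρ, h1, h2, h3⟩ := h.exists_root_logDensity hQ hs one_ne_zero
  have := h1.isProb
  have := (hν s hs.pos).isProb
  have h4 : ν s = ρ := Measure.ext_of_charFun (funext fun a => by
    rw [hexp s hs.pos, h2, Nat.cast_one, div_one])
  simpa [h4] using h3

lemma lintegral_secondMoment_lt_top {ν : ℝ → Measure H}
    (hν : ∀ s, 0 < s → IsCenteredL2 (ν s))
    (hexp : ∀ s, 0 < s → ∀ a, charFun (ν s) a = Complex.exp (logDensity T μ s a)) {t : ℝ}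
    (ht : 0 ≤ t) :
    ∫⁻ s in Set.Ioo 0 t, ∫⁻ x, (‖x‖₊ : ℝ≥0∞) ^ 2 ∂(ν s) < ⊤ := by
  refine lt_of_le_of_lt (lintegral_mono_ae ?_) ((lintegral_deriv_le h.monotoneOn_secondMoment
    (secondMoment_nonneg _) ht).trans_lt ENNReal.ofReal_lt_top)
  filter_upwards [ae_restrict_of_ae_restrict_of_subset Set.Ioo_subset_Ioi_self
    (h.ae_secondMoment_le hν hexp), ae_restrict_mem measurableSet_Ioo] with s h1 h2
  have := (hν s h2.1).isProb
  rw [lintegral_sq_eq_ofReal_secondMoment (hν s h2.1).memLp]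
  exact ENNReal.ofReal_le_ofReal h1

lemma hasDerivWithinAt_charFun (hs : 0 < s) (a : H) :
    HasDerivWithinAt (fun t => charFun (μ t) a) (charFun (μ s) a * logDensity T μ s a)
      (Set.Ici s) s := by
  rw [← hasDerivWithinAt_Ioi_iff_Ici, hasDerivWithinAt_iff_tendsto_slope' (by simp)]
  have h1 := (h.tendsto_logQuotient hs a).const_mul (charFun (μ s) a)
  have h2 : Tendsto (fun t => t - s) (nhdsWithin s (Set.Ioi s)) (nhdsWithin 0 (Set.Ioi 0)) := by
    refine tendsto_nhdsWithin_iff.2 ⟨?_, ?_⟩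
    · refine Tendsto.mono_left ?_ nhdsWithin_le_nhds
      simpa using (continuous_id.sub continuous_const).tendsto (x := s) (f := fun t => t - s)
    · filter_upwards [self_mem_nhdsWithin] with t ht
      exact Set.mem_Ioi.2 (sub_pos.2 (Set.mem_Ioi.1 ht))
  refine (h1.comp h2).congr' ?_
  filter_upwards [self_mem_nhdsWithin] with t ht
  rw [Function.comp_apply, h.charFun_mul_logQuotient (sub_nonneg.2 (le_of_lt ht)) hs.le,
    add_sub_cancel, slope_def_module]

lemma charFun_eq_mul_exp {ε t : ℝ} (hε : 0 < ε) (ht : ε ≤ t) (a : H) :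
    charFun (μ t) a
      = charFun (μ ε) a * Complex.exp (∫ s in ε..t, logDensity T μ s a) := by
  have hL : ContinuousOn (fun s => logDensity T μ s a) (Set.Ioi 0) :=
    h.isExponentFamily_logDensity.continuousOn h.isC0 a
  have hI : ∀ x, ε ≤ x → IntervalIntegrable (fun s => logDensity T μ s a) volume ε x :=
    fun x hx => ContinuousOn.intervalIntegrable (hL.mono fun y hy => by
      rw [Set.uIcc_of_le hx] at hy
      exact hε.trans_le hy.1)
  have hprim : ∀ x, ε ≤ x → HasDerivWithinAt
      (fun x => ∫ s in ε..x, logDensity T μ s a) (logDensity T μ x a) (Set.Ici x) x := by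
    intro x hx
    have hx0 : x ∈ Set.Ioi (0 : ℝ) := hε.trans_le hx
    refine (intervalIntegral.integral_hasDerivAt_right (hI x hx) ?_
      (hL.continuousAt (Ioi_mem_nhds hx0))).hasDerivWithinAt
    exact hL.stronglyMeasurableAtFilter isOpen_Ioi x hx0
  have hcont : ContinuousOn (fun x => ∫ s in ε..x, logDensity T μ s a) (Set.Icc ε t) := by
    intro x hx
    have hx0 : x ∈ Set.Ioi (0 : ℝ) := hε.trans_le hx.1
    exact (intervalIntegral.integral_hasDerivAt_right (hI x hx.1)
      (hL.stronglyMeasurableAtFilter isOpen_Ioi x hx0)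
      (hL.continuousAt (Ioi_mem_nhds hx0))).continuousAt.continuousWithinAt
  have hconst := constant_of_has_deriv_right_zero
    (f := fun x => charFun (μ x) a * Complex.exp (-∫ s in ε..x, logDensity T μ s a))
    (a := ε) (b := t)
    (((h.continuousOn_charFun a).mono fun x hx => hε.le.trans hx.1).mul hcont.neg.cexp)
    (fun x hx => by
      refine ((h.hasDerivWithinAt_charFun (hε.trans_le hx.1) a).mul
        (hprim x hx.1).neg.cexp).congr_deriv ?_
      ring)
    t (Set.right_mem_Icc.2 ht)
  simp only [intervalIntegral.integral_same, neg_zero, Complex.exp_zero, mul_one] at hconst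
  rw [← hconst, mul_assoc, ← Complex.exp_add, neg_add_cancel, Complex.exp_zero, mul_one]

lemma charFun_eq_exp {a : H} {t : ℝ} (ht : 0 ≤ t)
    (hint : IntegrableOn (fun s => logDensity T μ s a) (Set.Ioo 0 t)) :
    charFun (μ t) a = Complex.exp (∫ s in Set.Ioo 0 t, logDensity T μ s a) := by
  rcases ht.eq_or_lt with rfl | ht0
  · simp [h.charFun_zero_time a]
  rw [← intervalIntegrable_iff_integrableOn_Ioo_of_le ht] at hint
  rw [← integral_Ioc_eq_integral_Ioo, ← intervalIntegral.integral_of_le ht]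
  have h1 : Tendsto (fun ε => charFun (μ ε) a) (nhdsWithin 0 (Set.Ioi 0)) (nhds 1) := by
    rw [← h.charFun_zero_time a]
    exact ((h.continuousOn_charFun a) 0 Set.self_mem_Ici).mono_left
      (nhdsWithin_mono _ Set.Ioi_subset_Ici_self)
  have h2 : Tendsto (fun ε => ∫ s in ε..t, logDensity T μ s a) (nhdsWithin 0 (Set.Ioi 0))
      (nhds (∫ s in (0 : ℝ)..t, logDensity T μ s a)) := by
    have h3 := intervalIntegral.continuousOn_primitive_interval_left
      (f := fun s => logDensity T μ s a) (μ := volume) (a := 0) (b := t)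
      ((intervalIntegrable_iff_integrableOn_Icc_of_le ht).1 hint |>.mono_set
        (Set.uIcc_of_le ht).le)
    rw [Set.uIcc_of_le ht] at h3
    refine (h3 0 (Set.left_mem_Icc.2 ht)).mono_left ?_
    rw [← nhdsWithin_Ioo_eq_nhdsGT ht0]
    exact nhdsWithin_mono _ Set.Ioo_subset_Icc_self
  have h4 := h1.mul ((Complex.continuous_exp.tendsto _).comp h2)
  rw [one_mul] at h4
  refine tendsto_nhds_unique (tendsto_const_nhds.congr' ?_) h4
  rw [← nhdsWithin_Ioo_eq_nhdsGT ht0]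
  filter_upwards [self_mem_nhdsWithin] with ε hε
  exact h.charFun_eq_mul_exp hε.1 hε.2.le a

end IsCenteredSC

end RegularExponent

lemma IsCenteredSC.exists_representation {H : Type*} [NormedAddCommGroup H]
    [InnerProductSpace ℝ H] [CompleteSpace H] [MeasurableSpace H] [BorelSpace H]
    [SecondCountableTopology H] {T : ℝ → H →L[ℝ] H} {μ : ℝ → Measure H}
    (h : IsCenteredSC T μ) :
    ∃ ν : ℝ → Measure H,
      (∀ s, 0 < s → IsCenteredL2 (ν s)) ∧
      (∀ s, 0 < s → IsInfDiv (ν s)) ∧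
      (∀ r t, 0 < r → 0 < t → ν (r + t) = (ν r).map (T t)) ∧
      (∀ t : ℝ, 0 ≤ t → ∫⁻ s in Set.Ioo 0 t, ∫⁻ x, (‖x‖₊ : ℝ≥0∞) ^ 2 ∂(ν s) < ⊤) ∧
      (∀ s, 0 < s → ∀ a, charFun (ν s) a = Complex.exp (logDensity T μ s a)) ∧
      ∀ t, 0 ≤ t → ∀ a,
        charFun (μ t) a = Complex.exp (∫ s in Set.Ioo 0 t, logDensity T μ s a) := by
  have hL := h.isExponentFamily_logDensity
  have hex : ∀ s, ∃ ν : Measure H, 0 < s →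
      IsCenteredL2 ν ∧ ∀ a, charFun ν a = Complex.exp (logDensity T μ s a) := by
    intro s
    by_cases hs : 0 < s
    · obtain ⟨ν, h1, h2⟩ := (hL.isExponent s hs).exists_root 1 one_ne_zero
      exact ⟨ν, fun _ => ⟨h1, by simpa using h2⟩⟩
    · exact ⟨0, fun h0 => absurd h0 hs⟩
  choose ν hν using hex
  have hν2 : ∀ s, 0 < s → IsCenteredL2 (ν s) := fun s hs => (hν s hs).1
  have hexp : ∀ s, 0 < s → ∀ a, charFun (ν s) a = Complex.exp (logDensity T μ s a) :=
    fun s hs => (hν s hs).2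
  have hint := fun t ht => h.lintegral_secondMoment_lt_top hν2 hexp (t := t) ht
  refine ⟨ν, hν2, fun s hs => (hL.isExponent s hs).isInfDiv (hν2 s hs) (hexp s hs),
    fun r t hr ht => ?_, hint, hexp,
    fun t ht a => h.charFun_eq_exp ht (hL.integrableOn h.isC0 hν2 hexp (hint t ht) a)⟩
  have := (hν2 (r + t) (add_pos hr ht)).isProb
  have := ((hν2 r hr).map (T t)).isProb
  refine Measure.ext_of_charFun (funext fun a => ?_)
  rw [charFun_map_clm, hexp _ (add_pos hr ht), hexp r hr, hL.add_eq r t hr ht.le]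

/-- **Theorem 2.1.** A family `(μ_t)_{t≥0}` of centered probability measures on `H`
with finite second moments is an SC-semigroup associated with `(T_t)` if and only if
`μ̂_t(a) = exp{∫_0^t log ν̂_s(a) ds}` for a family `(ν_s)_{s>0}` of centered infinitely
divisible probability measures satisfying `ν_{r+t} = T_t ν_r` and
`∫_0^t ∫_H ‖x‖² ν_s(dx) ds < ∞`. -/
theorem sc_semigroup_iff_entrance_law_representation
    {H : Type*} [NormedAddCommGroup H] [InnerProductSpace ℝ H] [CompleteSpace H]
    [MeasurableSpace H] [BorelSpace H] [SecondCountableTopology H]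
    (T : ℝ → H →L[ℝ] H) (hT : IsC0 T)
    (μ : ℝ → Measure H)
    (hprob : ∀ t : ℝ, 0 ≤ t → IsProbabilityMeasure (μ t))
    (hcent : ∀ t : ℝ, 0 ≤ t → ∫ x, x ∂(μ t) = 0)
    (hmom : ∀ t : ℝ, 0 ≤ t → ∫⁻ x, (‖x‖₊ : ℝ≥0∞) ^ 2 ∂(μ t) < ⊤) :
    IsSC T μ ↔
      ∃ (ν : ℝ → Measure H) (L : ℝ → H → ℂ),
        (∀ s : ℝ, 0 < s → IsProbabilityMeasure (ν s)) ∧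
        (∀ s : ℝ, 0 < s → ∫ x, x ∂(ν s) = 0) ∧
        (∀ s : ℝ, 0 < s → IsInfDiv (ν s)) ∧
        (∀ r t : ℝ, 0 < r → 0 < t → ν (r + t) = (ν r).map (T t)) ∧
        (∀ t : ℝ, 0 ≤ t →
          ∫⁻ s in Set.Ioo 0 t, ∫⁻ x, (‖x‖₊ : ℝ≥0∞) ^ 2 ∂(ν s) < ⊤) ∧
        (∀ s : ℝ, 0 < s → Continuous (L s) ∧ L s 0 = 0 ∧
          ∀ a : H, Complex.exp (L s a) = charFn (ν s) a) ∧
        (∀ t : ℝ, 0 ≤ t → ∀ a : H,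
          charFn (μ t) a = Complex.exp (∫ s in Set.Ioo 0 t, L s a)) := by
  have hμ : ∀ t : ℝ, 0 ≤ t → IsCenteredL2 (μ t) := fun t ht =>
    have := hprob t ht
    isCenteredL2_of_lintegral_lt_top (hcent t ht) (hmom t ht)
  constructor
  · intro hSC
    have h : IsCenteredSC T μ := ⟨hT, hμ, hSC.2⟩
    obtain ⟨ν, h1, h2, h3, h4, h5, h6⟩ := h.exists_representation
    have hL := h.isExponentFamily_logDensity
    exact ⟨ν, logDensity T μ, fun s hs => (h1 s hs).isProb,
      fun s hs => (h1 s hs).integral_eq_zero, h2, h3, h4,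
      fun s hs => ⟨(hL.isExponent s hs).continuous, (hL.isExponent s hs).map_zero,
        fun a => (h5 s hs a).symm⟩, h6⟩
  · rintro ⟨ν, L, h1, h2, h3, h4, h5, h6, h7⟩
    exact isSC_of_representation hT hprob
      (fun s hs => isCenteredL2_of_entranceLaw h1 h2 h4 h5 hs) h3 h4 h5 h6 h7
end
end
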